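/- arXiv:2507.17246 — 3 statements merged into one kernel-verified Lean document; each statement's English description precedes it below -/
import Mathlib

section
/- Let G be a unicyclic graph of order n ≥ 3 with girth g. Then EUS(G) ≥ 2√3·n if g = n; EUS(G) ≥ 2√3·(n−3) + 2√19 + √13 if g = n−1; and EUS(G) ≥ 3√19 + 2(n−4)√3 + √7 if g ≤ n−2. Equality holds if and only if G ≅ C_n (when g = n), G ≅ C_{n,n−1} (when g = n−1), or G ≅ C_{n,g} (when g ≤ n−2). -/
open scoped Classical

noncomputable def eusWeight {V : Type*} [Fintype V] (G : SimpleGraph V) : Sym2 V → ℝ :=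
  Sym2.lift ⟨fun i j => Real.sqrt ((G.degree i : ℝ)^2 + (G.degree j : ℝ)^2 +
      (G.degree i : ℝ) * (G.degree j : ℝ)),
    fun i j => by ring_nf⟩

/-- The Euler Sombor index of a finite simple graph:
`EUS(G) = Σ_{v_i v_j ∈ E(G)} √(d_i² + d_j² + d_i d_j)`. -/
noncomputable def EUS {V : Type*} [Fintype V] (G : SimpleGraph V) : ℝ :=
  ∑ e ∈ G.edgeFinset, eusWeight G e

/-- `cycleWithPath n g` : the unicyclic graph `C_{n,g}` obtained from the cycle on vertices
`0, …, g-1` by attaching the pendant path `0 — g — (g+1) — ⋯ — (n-1)`.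
For `g = n` this is just the cycle `C_n`. -/
def cycleWithPath (n g : ℕ) : SimpleGraph (Fin n) :=
  SimpleGraph.fromRel (fun i j =>
    (j.val = i.val + 1 ∧ i.val + 1 ≠ g) ∨ (i.val = 0 ∧ (j.val = g - 1 ∨ j.val = g)))

section Aux
open Finset

lemma inc_card {V : Type*} [Fintype V] (G : SimpleGraph V) (v : V) :
    #{e ∈ G.edgeFinset | v ∈ e} = G.degree v := by
  rw [← SimpleGraph.incidenceFinset_eq_filter, SimpleGraph.card_incidenceFinset_eq_degree]

lemma sum_deg_sq {V : Type*} [Fintype V] (G : SimpleGraph V) :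
    ∑ e ∈ G.edgeFinset, (∑ v : V, if v ∈ e then (G.degree v : ℝ) else 0) =
      ∑ v, (G.degree v : ℝ) ^ 2 := by
  rw [Finset.sum_comm]
  refine Finset.sum_congr rfl fun v _ => ?_
  rw [← Finset.sum_filter, Finset.sum_const, inc_card, nsmul_eq_mul, sq]

lemma edge_sum {V : Type*} [Fintype V] (d : V → ℝ) (x y : V) (h : x ≠ y) :
    (∑ v : V, if v ∈ s(x, y) then d v else 0) = d x + d y := by
  rw [← Finset.sum_filter, ← Finset.sum_pair h]
  refine Finset.sum_congr ?_ fun _ _ => rfl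
  ext v; simp

lemma weight_lb (x y : ℝ) :
    √3 / 2 * (x + y) ≤ √(x ^ 2 + y ^ 2 + x * y) := by
  apply Real.le_sqrt_of_sq_le
  rw [mul_pow, div_pow, Real.sq_sqrt (by norm_num)]
  nlinarith [sq_nonneg (x - y)]

lemma eus_lb {V : Type*} [Fintype V] (G : SimpleGraph V) :
    √3 / 2 * ∑ v, (G.degree v : ℝ) ^ 2 ≤ EUS G := by
  rw [← sum_deg_sq, Finset.mul_sum]
  refine Finset.sum_le_sum fun e he => ?_
  induction e with
  | _ x y =>
    have hxy : G.Adj x y := by simpa using he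
    rw [edge_sum _ _ _ hxy.ne]
    exact weight_lb _ _

lemma two_leaves {V : Type*} [Fintype V] (G : SimpleGraph V) (n : ℕ)
    (hcard : Fintype.card V = n) (hs : ∑ v, G.degree v = 2 * n)
    (a b : V) (hab : a ≠ b) (ha : G.degree a = 1) (hb : G.degree b = 1) :
    2 * √3 * (n + 1) ≤ EUS G := by
  refine le_trans ?_ (eus_lb G)
  have h1 : ∀ v : V, (5 * (G.degree v : ℤ) - 6) + ((if v = a then 2 else 0) +
      (if v = b then 2 else 0)) ≤ (G.degree v : ℤ) ^ 2 := by
    intro v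
    by_cases h : v = a
    · subst h; simp [ha, hab]
    · by_cases h' : v = b
      · subst h'; simp [hb, h]
      · simp only [h, h', if_false]
        generalize (G.degree v : ℤ) = d
        rcases le_or_gt d 2 with h2 | h2 <;> nlinarith
  have h2 := Finset.sum_le_sum (s := Finset.univ) fun v _ => h1 v
  simp only [Finset.sum_add_distrib, Finset.sum_sub_distrib, ← Finset.mul_sum,
    Finset.sum_ite_eq', Finset.mem_univ, if_true, Finset.sum_const, Finset.card_univ, hcard] at h2
  have h3 : ∑ v, (G.degree v : ℤ) = 2 * n := by exact_mod_cast hs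
  rw [h3] at h2
  have h4 : (4 * n + 4 : ℝ) ≤ ∑ v, (G.degree v : ℝ) ^ 2 := by
    have : (4 * n + 4 : ℤ) ≤ ∑ v, (G.degree v : ℤ) ^ 2 := by
      simp at h2; linarith
    exact_mod_cast this
  nlinarith [Real.sqrt_nonneg 3]

lemma num1 (n : ℝ) : 2 * √3 * (n - 3) + 2 * √19 + √13 < 2 * √3 * (n + 1) := by
  have h3 : (1.73 : ℝ) < √3 := Real.lt_sqrt_of_sq_lt (by norm_num)
  have h19 : √19 < 4.36 := by rw [Real.sqrt_lt' (by norm_num)]; norm_num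
  have h13 : √13 < 3.61 := by rw [Real.sqrt_lt' (by norm_num)]; norm_num
  linarith

lemma num2 (n : ℝ) : 3 * √19 + 2 * (n - 4) * √3 + √7 < 2 * √3 * (n + 1) := by
  have h3 : (1.73 : ℝ) < √3 := Real.lt_sqrt_of_sq_lt (by norm_num)
  have h19 : √19 < 4.36 := by rw [Real.sqrt_lt' (by norm_num)]; norm_num
  have h7 : √7 < 2.65 := by rw [Real.sqrt_lt' (by norm_num)]; norm_num
  linarith

lemma sqrt12 : √12 = 2 * √3 := by
  rw [show (12 : ℝ) = 2 ^ 2 * 3 by norm_num, Real.sqrt_mul (by norm_num), Real.sqrt_sq (by norm_num)]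

lemma eus_regular {V : Type*} [Fintype V] (G : SimpleGraph V) (n : ℕ)
    (he : #G.edgeFinset = n) (h2 : ∀ v, G.degree v = 2) : EUS G = 2 * √3 * n := by
  unfold EUS
  rw [Finset.sum_congr rfl (g := fun _ => 2 * √3)]
  · rw [Finset.sum_const, he, nsmul_eq_mul]; ring
  · intro e _
    induction e with
    | _ x y =>
      simp only [eusWeight, Sym2.lift_mk, h2]
      rw [← sqrt12]; norm_num

lemma eus_one_leaf {V : Type*} [Fintype V] (G : SimpleGraph V) (n : ℕ)
    (he : #G.edgeFinset = n) (a b : V) (hab : a ≠ b) (ha : G.degree a = 1) (hb : G.degree b = 3)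
    (h2 : ∀ v, v ≠ a → v ≠ b → G.degree v = 2) :
    EUS G = 2 * √3 * n + 3 * (√19 - 2 * √3) + (√7 - 2 * √3) +
      (if G.Adj a b then √13 - √19 - √7 + 2 * √3 else 0) := by
  unfold EUS
  have key : ∀ e ∈ G.edgeFinset, eusWeight G e = 2 * √3 +
      (if b ∈ e then (√19 - 2 * √3) else 0) + (if a ∈ e then (√7 - 2 * √3) else 0) +
      (if e = s(a, b) then √13 - √19 - √7 + 2 * √3 else 0) := by
    intro e he
    induction e with
    | _ x y =>
      have hxy : x ≠ y := by
        have : G.Adj x y := by simpa using he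
        exact this.ne
      have hba := hab.symm
      simp only [eusWeight, Sym2.lift_mk]
      have hs := sqrt12
      by_cases hxa : x = a
      · subst hxa
        by_cases hyb : y = b
        · subst hyb; simp [ha, hb]; norm_num; ring
        · have := h2 y hxy.symm hyb
          simp [ha, hba, hab, this, Ne.symm hyb, hyb]; norm_num
      · by_cases hxb : x = b
        · subst hxb
          by_cases hya : y = a
          · subst hya; simp [ha, hb, Sym2.eq_swap]; norm_num; ring
          · have := h2 y hya hxy.symm
            simp [hb, this, hya, Ne.symm hya, hab, hxa]; norm_num
        · have hx := h2 x hxa hxb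
          by_cases hya : y = a
          · subst hya
            simp [ha, hx, hxa, Ne.symm hxb, hba, hxb]; norm_num
          · by_cases hyb : y = b
            · subst hyb
              simp [hb, hx, hxa, Ne.symm hxa, hab, hxb]; norm_num
            · have := h2 y hya hyb
              simp [hx, this, hxa, hxb, hya, hyb, Ne.symm hxa, Ne.symm hxb, Ne.symm hya,
                Ne.symm hyb]
              rw [← sqrt12]; norm_num
  rw [Finset.sum_congr rfl key]
  simp only [Finset.sum_add_distrib]
  rw [← Finset.sum_filter, ← Finset.sum_filter]
  simp only [Finset.sum_const, inc_card, Finset.sum_ite_eq', ha, hb, he, nsmul_eq_mul,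
    SimpleGraph.mem_edgeFinset, SimpleGraph.mem_edgeSet]
  push_cast
  ring

lemma closed_univ {V : Type*} (G : SimpleGraph V) (hc : G.Connected) (S : Set V) (x : V)
    (hx : x ∈ S) (h : ∀ u v, u ∈ S → G.Adj u v → v ∈ S) (v : V) : v ∈ S := by
  obtain ⟨w⟩ := hc.preconnected x v
  induction w with
  | nil => exact hx
  | cons hadj _ ih => exact ih (h _ _ hx hadj)

lemma nbr_of_card {V : Type*} [Fintype V] (G : SimpleGraph V) (v : V) (s : Finset V)
    (hs : ∀ x ∈ s, G.Adj v x) (hd : G.degree v ≤ #s) (z : V) (hz : G.Adj v z) : z ∈ s := by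
  have h1 : s ⊆ G.neighborFinset v := fun x hx => by simpa using hs x hx
  have h2 : s = G.neighborFinset v := Finset.eq_of_subset_of_card_le h1 hd
  rw [h2]; simpa using hz

lemma card_le_deg {V : Type*} [Fintype V] (G : SimpleGraph V) (v : V) (s : Finset V)
    (hs : ∀ x ∈ s, G.Adj v x) : #s ≤ G.degree v :=
  Finset.card_le_card (fun x hx => by simpa using hs x hx)

/-- Adjacency facts of the model graph. -/
lemma cwp_adj (n g : ℕ) (i j : Fin n) : (cycleWithPath n g).Adj i j ↔ i ≠ j ∧
    (((j.val = i.val + 1 ∧ i.val + 1 ≠ g) ∨ (i.val = 0 ∧ (j.val = g - 1 ∨ j.val = g))) ∨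
    ((i.val = j.val + 1 ∧ j.val + 1 ≠ g) ∨ (j.val = 0 ∧ (i.val = g - 1 ∨ i.val = g)))) := by
  unfold cycleWithPath
  rw [SimpleGraph.fromRel_adj]

lemma cwp_edges (n g : ℕ) (hg : 3 ≤ g) (hgn : g ≤ n) :
    n ≤ #(cycleWithPath n g).edgeFinset := by
  let par : Fin n → Fin n := fun i =>
    if i.val = 0 then ⟨g - 1, by omega⟩ else if i.val = g then ⟨0, by omega⟩
    else ⟨i.val - 1, by omega⟩
  have hpar : ∀ i, (par i).val = if i.val = 0 then g - 1 else if i.val = g then 0 else i.val - 1 := by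
    intro i; simp only [par]; split_ifs <;> rfl
  have := Finset.card_le_card_of_injOn (s := (Finset.univ : Finset (Fin n)))
    (t := (cycleWithPath n g).edgeFinset) (fun i => s(i, par i)) ?_ ?_
  · simpa using this
  · intro i _
    have := hpar i
    simp only [SimpleGraph.coe_edgeFinset, SimpleGraph.mem_edgeSet, cwp_adj, ne_eq, Fin.ext_iff]
    split_ifs at this <;> omega
  · intro i _ j _ hij
    have h1 := hpar i
    have h2 := hpar j
    simp only [Sym2.eq_iff, Fin.ext_iff] at hij ⊢
    split_ifs at h1 h2 <;> omega

lemma iso_of_inj {V : Type*} [Fintype V] (G : SimpleGraph V) (n g : ℕ) (hg : 3 ≤ g) (hgn : g ≤ n)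
    (hcard : Fintype.card V = n) (he : #G.edgeFinset = n) (f : Fin n → V)
    (hf : Function.Injective f) (hadj : ∀ i j, (cycleWithPath n g).Adj i j → G.Adj (f i) (f j)) :
    Nonempty (G ≃g cycleWithPath n g) := by
  have hb : Function.Bijective f :=
    (Fintype.bijective_iff_injective_and_card f).2 ⟨hf, by simp [hcard]⟩
  have himg : (cycleWithPath n g).edgeFinset.image (Sym2.map f) = G.edgeFinset := by
    apply Finset.eq_of_subset_of_card_le
    · intro e he
      obtain ⟨e', he', rfl⟩ := Finset.mem_image.1 he
      induction e' with
      | _ x y =>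
        simp only [SimpleGraph.mem_edgeFinset, SimpleGraph.mem_edgeSet, Sym2.map_mk] at he' ⊢
        exact hadj _ _ he'
    · rw [Finset.card_image_of_injective _ (Sym2.map.injective hf), he]
      exact cwp_edges n g hg hgn
  refine ⟨SimpleGraph.Iso.symm ⟨Equiv.ofBijective f hb, ?_⟩⟩
  intro i j
  refine ⟨fun h => ?_, hadj i j⟩
  have h1 : s(f i, f j) ∈ G.edgeFinset := by simpa using h
  rw [← himg] at h1
  obtain ⟨e', he', h2⟩ := Finset.mem_image.1 h1
  have : e' = s(i, j) := Sym2.map.injective hf (by simpa using h2)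
  subst this
  simpa using he'

lemma cwp_leaf (n g : ℕ) (hg : 3 ≤ g) (hgn : g ≤ n) (i : Fin n)
    (hi : (cycleWithPath n g).degree i = 1) : i.val = n - 1 := by
  by_contra hne
  have hlt : i.val + 1 < n := by omega
  have key : ∀ x y : Fin n, x ≠ y → (cycleWithPath n g).Adj i x → (cycleWithPath n g).Adj i y →
      False := by
    intro x y hxy hx hy
    have := card_le_deg (cycleWithPath n g) i {x, y} (by simp [hx, hy])
    rw [Finset.card_pair hxy] at this
    omega
  by_cases h0 : i.val = 0
  · apply key ⟨1, by omega⟩ ⟨g - 1, by omega⟩ <;>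
      simp only [cwp_adj, ne_eq, Fin.ext_iff, true_and, true_or, and_true] <;> omega
  · by_cases h1 : i.val = g
    · apply key ⟨0, by omega⟩ ⟨i.val + 1, by omega⟩ <;>
        simp only [cwp_adj, ne_eq, Fin.ext_iff, true_and, true_or, and_true] <;> omega
    · by_cases h2 : i.val + 1 = g
      · apply key ⟨0, by omega⟩ ⟨i.val - 1, by omega⟩ <;>
          simp only [cwp_adj, ne_eq, Fin.ext_iff, true_and, true_or, and_true] <;> omega
      · apply key ⟨i.val - 1, by omega⟩ ⟨i.val + 1, by omega⟩ <;>
          simp only [cwp_adj, ne_eq, Fin.ext_iff, true_and, true_or, and_true] <;> omega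

lemma leaf_unique_of_iso {V : Type*} [Fintype V] (G : SimpleGraph V) (n g : ℕ) (hg : 3 ≤ g)
    (hgn : g ≤ n) (φ : G ≃g cycleWithPath n g) (a b : V) (ha : G.degree a = 1)
    (hb : G.degree b = 1) : a = b := by
  have h1 := cwp_leaf n g hg hgn (φ a) (by rw [φ.degree_eq, ha])
  have h2 := cwp_leaf n g hg hgn (φ b) (by rw [φ.degree_eq, hb])
  apply φ.injective
  ext; omega

/-- Vertices of a cycle as a function on naturals. -/
structure CycFun {V : Type*} (G : SimpleGraph V) (g : ℕ) (c : ℕ → V) : Prop where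
  three : 3 ≤ g
  closed : c g = c 0
  adj : ∀ i < g, G.Adj (c i) (c (i + 1))
  inj : ∀ i < g, ∀ j < g, c i = c j → i = j

lemma cycFun_of_walk {V : Type*} (G : SimpleGraph V) (u : V) (w : G.Walk u u) (hw : w.IsCycle) :
    CycFun G w.length w.getVert := by
  refine ⟨hw.three_le_length, by simp, fun i hi => w.adj_getVert_succ hi, fun i hi j hj h => ?_⟩
  exact hw.getVert_injOn' (by simp only [Set.mem_ofPred_eq]; omega)
    (by simp only [Set.mem_ofPred_eq]; omega) h

lemma CycFun.two {V : Type*} {G : SimpleGraph V} {g : ℕ} {c : ℕ → V}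
    (h : CycFun G g c) (k : ℕ) (hk : k < g) : ∃ i < g, ∃ j < g, c i ≠ c j ∧
      G.Adj (c k) (c i) ∧ G.Adj (c k) (c j) := by
  have h3 := h.three
  have hinj : ∀ i < g, ∀ j < g, i ≠ j → c i ≠ c j := fun i hi j hj hne e => hne (h.inj i hi j hj e)
  by_cases h0 : k = 0
  · subst h0
    refine ⟨1, by omega, g - 1, by omega, hinj _ (by omega) _ (by omega) (by omega),
      h.adj 0 hk, ?_⟩
    have := h.adj (g - 1) (by omega)
    rw [Nat.sub_add_cancel (by omega), h.closed] at this
    exact this.symm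
  · have hp := h.adj (k - 1) (by omega)
    rw [Nat.sub_add_cancel (by omega)] at hp
    by_cases h1 : k + 1 = g
    · refine ⟨0, by omega, k - 1, by omega, hinj _ (by omega) _ (by omega) (by omega), ?_, hp.symm⟩
      have := h.adj k hk
      rwa [h1, h.closed] at this
    · exact ⟨k + 1, by omega, k - 1, by omega, hinj _ (by omega) _ (by omega) (by omega),
        h.adj k hk, hp.symm⟩

/-- Degree analysis when there is at most one leaf and a vertex of degree at least three. -/
lemma degs {V : Type*} [Fintype V] (G : SimpleGraph V) (n : ℕ)
    (hcard : Fintype.card V = n) (hs : ∑ v, G.degree v = 2 * n) (hpos : ∀ v, 1 ≤ G.degree v)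
    (huniq : ∀ a b, G.degree a = 1 → G.degree b = 1 → a = b) (b : V) (hb : 3 ≤ G.degree b) :
    ∃ a, a ≠ b ∧ G.degree a = 1 ∧ G.degree b = 3 ∧ ∀ v, v ≠ a → v ≠ b → G.degree v = 2 := by
  by_cases hex : ∃ a, G.degree a = 1
  · obtain ⟨a, ha⟩ := hex
    have hab : a ≠ b := by rintro rfl; omega
    have h1 : ∀ v ∈ (Finset.univ : Finset V), 2 + (if v = b then 1 else 0) ≤
        G.degree v + (if v = a then 1 else 0) := by
      intro v _
      have h := hpos v
      by_cases hva : v = a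
      · subst hva; simp [hab]; omega
      · by_cases hvb : v = b
        · subst hvb; simp [hva]; omega
        · have : G.degree v ≠ 1 := fun e => hva (huniq _ _ e ha)
          simp [hva, hvb]; omega
    have h2 := (Finset.sum_eq_sum_iff_of_le h1).1 (by
      simp only [Finset.sum_add_distrib, Finset.sum_const, Finset.card_univ, hcard, hs,
        Finset.sum_ite_eq', Finset.mem_univ, if_true, smul_eq_mul]; omega)
    refine ⟨a, hab, ha, ?_, fun v hva hvb => ?_⟩
    · have := h2 b (Finset.mem_univ _); simp [hab.symm] at this; omega
    · have := h2 v (Finset.mem_univ _); simp [hva, hvb] at this; omega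
  · exfalso
    have h1 : ∀ v ∈ (Finset.univ : Finset V), 2 + (if v = b then 1 else 0) ≤ G.degree v := by
      intro v _
      have h := hpos v
      have h' : G.degree v ≠ 1 := fun e => hex ⟨v, e⟩
      split_ifs with hv
      · subst hv; omega
      · omega
    have h2 := Finset.sum_le_sum h1
    simp only [Finset.sum_add_distrib, Finset.sum_const, Finset.card_univ, hcard, hs,
        Finset.sum_ite_eq', Finset.mem_univ, if_true, smul_eq_mul] at h2
    omega

lemma structure_thm {V : Type*} [Fintype V] (G : SimpleGraph V) (n g : ℕ)
    (hcard : Fintype.card V = n) (hc : G.Connected) (he : #G.edgeFinset = n) (a b : V)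
    (hab : a ≠ b) (ha : G.degree a = 1) (hb : G.degree b = 3)
    (h2 : ∀ v, v ≠ a → v ≠ b → G.degree v = 2) (c : ℕ → V) (hcyc : CycFun G g c) (hc0 : c 0 = b) :
    g + 1 ≤ n ∧ (G.Adj a b ↔ n = g + 1) ∧ Nonempty (G ≃g cycleWithPath n g) := by
  have h3 := hcyc.three
  obtain ⟨p, hp⟩ := hc.exists_isPath b a
  obtain ⟨m, q, hq0, hqm, hqadj, hqinj⟩ : ∃ (m : ℕ) (q : ℕ → V), q 0 = b ∧ q m = a ∧
      (∀ i < m, G.Adj (q i) (q (i + 1))) ∧ (∀ i ≤ m, ∀ j ≤ m, q i = q j → i = j) :=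
    ⟨p.length, p.getVert, by simp, by simp, fun i hi => p.adj_getVert_succ hi,
      fun i hi j hj h => hp.getVert_injOn hi hj h⟩
  have hm : 1 ≤ m := by
    rcases Nat.eq_zero_or_pos m with h | h
    · subst h; exact absurd (hqm.symm.trans hq0) hab
    · exact h
  -- the leaf is not on the cycle
  have hac : ∀ k < g, c k ≠ a := by
    intro k hk e
    obtain ⟨i, hi, j, hj, hij, h1, h2⟩ := hcyc.two k hk
    have := card_le_deg G (c k) {c i, c j} (by simp [h1, h2])
    rw [Finset.card_pair hij, e, ha] at this
    omega
  -- non-base cycle vertices have all neighbours on the cycle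
  have hcn : ∀ k < g, c k ≠ b → ∀ z, G.Adj (c k) z → ∃ l < g, z = c l := by
    intro k hk hkb z hz
    obtain ⟨i, hi, j, hj, hij, h1, h2'⟩ := hcyc.two k hk
    have := nbr_of_card G (c k) {c i, c j} (by simp [h1, h2'])
      (by rw [Finset.card_pair hij, h2 _ (hac k hk) hkb]) z hz
    simp only [Finset.mem_insert, Finset.mem_singleton] at this
    rcases this with h | h
    · exact ⟨i, hi, h⟩
    · exact ⟨j, hj, h⟩
  have hqb : ∀ i ≤ m, 0 < i → q i ≠ b := by
    intro i hi hpos e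
    have := hqinj i hi 0 (by omega) (e.trans hq0.symm)
    omega
  have hqc : ∀ i ≤ m, 0 < i → ∀ k < g, q i ≠ c k := by
    intro i hi hpos k hk e
    have : ∀ j, i ≤ j → j ≤ m → ∃ l < g, q j = c l := by
      intro j hij
      induction j, hij using Nat.le_induction with
      | base => intro _; exact ⟨k, hk, e⟩
      | succ j hij ih =>
        intro hjm
        obtain ⟨l, hl, hjl⟩ := ih (by omega)
        exact hcn l hl (hjl ▸ hqb j (by omega) (by omega)) _ (hjl ▸ hqadj j (by omega))
    obtain ⟨l, hl, h⟩ := this m hi le_rfl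
    exact hac l hl (h.symm.trans hqm)
  -- closure
  have hlast : G.Adj (c 0) (c (g - 1)) := by
    have := hcyc.adj (g - 1) (by omega)
    rw [Nat.sub_add_cancel (by omega), hcyc.closed] at this
    exact this.symm
  have hq1 : G.Adj (c 0) (q 1) := by
    have := hqadj 0 (by omega)
    rwa [hq0, ← hc0] at this
  let f : Fin (g + m) → V := fun i => if i.val < g then c i.val else q (i.val - g + 1)
  have hinj : Function.Injective f := by
    intro i j hij
    simp only [f] at hij
    have hi := i.2
    have hj := j.2
    apply Fin.ext
    split_ifs at hij with h1 h2 h2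
    · exact hcyc.inj _ h1 _ h2 hij
    · exact absurd hij.symm (hqc _ (by omega) (by omega) _ h1)
    · exact absurd hij (hqc _ (by omega) (by omega) _ h2)
    · have := hqinj _ (by omega) _ (by omega) hij
      omega
  have hcf : ∀ k < g, c k ∈ Set.range f := fun k hk =>
    ⟨⟨k, by omega⟩, by simp [f, hk]⟩
  have hqf : ∀ k ≤ m, q k ∈ Set.range f := by
    intro k hk
    rcases Nat.eq_zero_or_pos k with h | h
    · subst h; rw [hq0, ← hc0]; exact hcf 0 (by omega)
    · refine ⟨⟨g + k - 1, by omega⟩, ?_⟩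
      have h1 : ¬ (g + k - 1 < g) := by omega
      have h2 : g + k - 1 - g + 1 = k := by omega
      simp only [f, h1, if_false, h2]
  have hclosed : ∀ u v, u ∈ Set.range f → G.Adj u v → v ∈ Set.range f := by
    rintro u v ⟨i, rfl⟩ hadj
    simp only [f] at hadj
    have hi2 := i.2
    split_ifs at hadj with hi
    · by_cases hib : c i = b
      · rw [hib] at hadj
        have hcard3 : #({c 1, c (g - 1), q 1} : Finset V) = 3 := by
          rw [Finset.card_eq_three]
          refine ⟨_, _, _, ?_, ?_, ?_, rfl⟩
          · intro e; have := hcyc.inj _ (by omega) _ (by omega) e; omega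
          · exact (hqc 1 hm (by omega) _ (by omega)).symm
          · exact (hqc 1 hm (by omega) _ (by omega)).symm
        have hc1 := hcyc.adj 0 (by omega)
        rw [hc0] at hc1 hlast hq1
        have := nbr_of_card G b {c 1, c (g - 1), q 1} (by simp_all)
          (by rw [hcard3, hb]) v hadj
        simp only [Finset.mem_insert, Finset.mem_singleton] at this
        rcases this with rfl | rfl | rfl
        · exact hcf _ (by omega)
        · exact hcf _ (by omega)
        · exact hqf _ hm
      · obtain ⟨l, hl, rfl⟩ := hcn i hi hib v hadj
        exact hcf l hl
    · set k := i.val - g + 1 with hk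
      have hprev := hqadj (k - 1) (by omega)
      rw [Nat.sub_add_cancel (by omega)] at hprev
      by_cases hkm : k = m
      · have := nbr_of_card G (q k) {q (k - 1)} (by simpa using hprev.symm)
          (by rw [Finset.card_singleton, hkm, hqm, ha]) v hadj
        rw [Finset.mem_singleton] at this
        rw [this]; exact hqf _ (by omega)
      · have hka : q k ≠ a := by
          intro e
          exact hkm (hqinj _ (by omega) _ le_rfl (e.trans hqm.symm))
        have hne : q (k - 1) ≠ q (k + 1) := by
          intro e; have := hqinj _ (by omega) _ (by omega) e; omega
        have := nbr_of_card G (q k) {q (k - 1), q (k + 1)}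
          (by simp [hprev.symm, hqadj k (by omega)])
          (by rw [Finset.card_pair hne, h2 _ hka (hqb k (by omega) (by omega))]) v hadj
        simp only [Finset.mem_insert, Finset.mem_singleton] at this
        rcases this with rfl | rfl
        · exact hqf _ (by omega)
        · exact hqf _ (by omega)
  have hsurj : Function.Surjective f :=
    closed_univ G hc (Set.range f) (c 0) (hcf 0 (by omega)) hclosed
  have hn : n = g + m := by
    rw [← hcard, ← Fintype.card_of_bijective ⟨hinj, hsurj⟩]; simp
  subst hn
  refine ⟨by omega, ⟨fun h => ?_, fun h => ?_⟩, ?_⟩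
  · have hprev := hqadj (m - 1) (by omega)
    rw [Nat.sub_add_cancel (by omega), hqm] at hprev
    have := nbr_of_card G a {q (m - 1)} (by simpa using hprev.symm) (by simp [ha]) b h
    rw [Finset.mem_singleton, ← hq0] at this
    have := hqinj _ (by omega) _ (by omega) this
    omega
  · have : m = 1 := by omega
    subst this
    rw [hqm, hc0] at hq1
    exact hq1.symm
  · refine iso_of_inj G (g + m) g h3 (by omega) hcard he f hinj ?_
    have half : ∀ i j : Fin (g + m), ((j.val = i.val + 1 ∧ i.val + 1 ≠ g) ∨
        (i.val = 0 ∧ (j.val = g - 1 ∨ j.val = g))) → G.Adj (f i) (f j) := by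
      intro i j h
      have hi2 := i.2
      have hj2 := j.2
      simp only [f]
      rcases h with ⟨h, hne⟩ | ⟨h0, h | h⟩
      · by_cases hi : i.val < g
        · have hj : j.val < g := by omega
          simp only [hi, hj, if_true]; rw [h]; exact hcyc.adj _ hi
        · have hj : ¬ j.val < g := by omega
          simp only [hi, hj, if_false]
          rw [show j.val - g + 1 = (i.val - g + 1) + 1 by omega]
          exact hqadj _ (by omega)
      · rw [if_pos (by omega), if_pos (by omega), h0, h]; exact hlast
      · rw [if_pos (by omega), if_neg (by omega), h0, h]; simpa using hq1
    intro i j hij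
    rw [cwp_adj] at hij
    rcases hij.2 with h | h
    · exact half i j h
    · exact (half j i h).symm

lemma cycle_iso {V : Type*} [Fintype V] (G : SimpleGraph V) (n : ℕ)
    (hcard : Fintype.card V = n) (he : #G.edgeFinset = n) (c : ℕ → V) (hcyc : CycFun G n c) :
    Nonempty (G ≃g cycleWithPath n n) := by
  have h3 := hcyc.three
  refine iso_of_inj G n n h3 le_rfl hcard he (fun i => c i.val) ?_ ?_
  · intro i j hij
    exact Fin.ext (hcyc.inj _ i.2 _ j.2 hij)
  · have half : ∀ i j : Fin n, ((j.val = i.val + 1 ∧ i.val + 1 ≠ n) ∨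
        (i.val = 0 ∧ (j.val = n - 1 ∨ j.val = n))) → G.Adj (c i) (c j) := by
      intro i j h
      have hj2 := j.2
      rcases h with ⟨h, hne⟩ | ⟨h0, h | h⟩
      · rw [h]; exact hcyc.adj _ i.2
      · have := hcyc.adj (n - 1) (by omega)
        rw [Nat.sub_add_cancel (by omega), hcyc.closed] at this
        rw [h0, h]; exact this.symm
      · omega
    intro i j hij
    rw [cwp_adj] at hij
    rcases hij.2 with h | h
    · exact half i j h
    · exact (half j i h).symm

lemma cycle_eus {V : Type*} [Fintype V] (G : SimpleGraph V) (n : ℕ)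
    (hcard : Fintype.card V = n) (he : #G.edgeFinset = n) (hs : ∑ v, G.degree v = 2 * n)
    (c : ℕ → V) (hcyc : CycFun G n c) : EUS G = 2 * √3 * n := by
  have hinj : Function.Injective (fun i : Fin n => c i.val) := fun i j hij =>
    Fin.ext (hcyc.inj _ i.2 _ j.2 hij)
  have hb := (Fintype.bijective_iff_injective_and_card _).2 ⟨hinj, by simp [hcard]⟩
  have h1 : ∀ v ∈ (Finset.univ : Finset V), 2 ≤ G.degree v := by
    intro v _
    obtain ⟨k, rfl⟩ := hb.2 v
    obtain ⟨i, hi, j, hj, hij, h1, h2⟩ := hcyc.two k k.2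
    have := card_le_deg G (c k) {c i, c j} (by simp [h1, h2])
    rwa [Finset.card_pair hij] at this
  have h2 := (Finset.sum_eq_sum_iff_of_le h1).1 (by simp [hs, hcard, mul_comm])
  exact eus_regular G n he fun v => (h2 v (Finset.mem_univ v)).symm

lemma rebase {V : Type*} [Fintype V] (G : SimpleGraph V) (n : ℕ) (hcard : Fintype.card V = n)
    (hc : G.Connected) (u : V) (w : G.Walk u u) (hw : w.IsCycle) (hlt : w.length < n) :
    ∃ c, CycFun G w.length c ∧ 3 ≤ G.degree (c 0) := by
  have hex : ∃ b z, b ∈ w.support ∧ z ∉ w.support ∧ G.Adj b z := by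
    by_contra hno
    push Not at hno
    have hall := closed_univ G hc {x | x ∈ w.support} u w.start_mem_support
      (fun x y hx hxy => by
        by_contra hy
        exact hno x y hx hy hxy)
    have hsurj : Function.Surjective (fun i : Fin w.length => w.getVert i.val) := by
      intro v
      obtain ⟨k, hk, hkl⟩ := SimpleGraph.Walk.mem_support_iff_exists_getVert.1 (hall v)
      have h3 := hw.three_le_length
      rcases Nat.lt_or_ge k w.length with h | h
      · exact ⟨⟨k, h⟩, hk⟩
      · refine ⟨⟨0, by omega⟩, ?_⟩
        have : k = w.length := by omega
        subst this
        simpa using hk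
    have := Fintype.card_le_of_surjective _ hsurj
    simp [hcard] at this
    omega
  obtain ⟨b, z, hb, hz, hbz⟩ := hex
  have hcyc := cycFun_of_walk G b (w.rotate b hb) (hw.rotate hb)
  rw [SimpleGraph.Walk.length_rotate] at hcyc
  refine ⟨_, hcyc, ?_⟩
  obtain ⟨i, hi, j, hj, hij, h1, h2⟩ := hcyc.two 0 (by have := hcyc.three; omega)
  have hzn : ∀ k, (w.rotate b hb).getVert k ≠ z := by
    intro k e
    apply hz
    rw [← SimpleGraph.Walk.mem_support_rotate_iff w b hb, ← e]
    exact SimpleGraph.Walk.getVert_mem_support _ _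
  have h3 := card_le_deg G ((w.rotate b hb).getVert 0)
    {(w.rotate b hb).getVert i, (w.rotate b hb).getVert j, z} (by simp_all)
  rwa [Finset.card_eq_three.2 ⟨_, _, _, hij, hzn i, hzn j, rfl⟩] at h3

end Aux

/-- Let `G` be a unicyclic graph of order `n ≥ 3` with girth `g`. Then
`EUS(G) ≥ 2√3·n` if `g = n`, `EUS(G) ≥ 2√3·(n-3) + 2√19 + √13` if `g = n-1`, and
`EUS(G) ≥ 3√19 + 2(n-4)√3 + √7` if `g ≤ n-2`; in each case equality holds if and only if
`G ≅ C_n`, `G ≅ C_{n,n-1}`, `G ≅ C_{n,g}` respectively. -/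
theorem eus_min_unicyclic_girth {V : Type*} [Fintype V] (G : SimpleGraph V) (n g : ℕ)
    (hn : 3 ≤ n) (hcard : Fintype.card V = n)
    (hconn : G.Connected) (hunicyclic : G.edgeSet.ncard = Fintype.card V)
    (hg : G.egirth = (g : ℕ∞)) :
    (g = n →
      2 * Real.sqrt 3 * n ≤ EUS G ∧
        (EUS G = 2 * Real.sqrt 3 * n ↔ Nonempty (G ≃g cycleWithPath n n))) ∧
    (g = n - 1 →
      2 * Real.sqrt 3 * ((n : ℝ) - 3) + 2 * Real.sqrt 19 + Real.sqrt 13 ≤ EUS G ∧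
        (EUS G = 2 * Real.sqrt 3 * ((n : ℝ) - 3) + 2 * Real.sqrt 19 + Real.sqrt 13 ↔
          Nonempty (G ≃g cycleWithPath n (n - 1)))) ∧
    (g + 2 ≤ n →
      3 * Real.sqrt 19 + 2 * ((n : ℝ) - 4) * Real.sqrt 3 + Real.sqrt 7 ≤ EUS G ∧
        (EUS G = 3 * Real.sqrt 19 + 2 * ((n : ℝ) - 4) * Real.sqrt 3 + Real.sqrt 7 ↔
          Nonempty (G ≃g cycleWithPath n g))) := by
  have he : G.edgeFinset.card = n := by
    rw [← hcard, ← hunicyclic, Set.ncard_eq_toFinset_card', SimpleGraph.edgeFinset]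
  have hs : ∑ v, G.degree v = 2 * n := by
    rw [SimpleGraph.sum_degrees_eq_twice_card_edges, he]
  have hac : ¬ G.IsAcyclic := by
    intro h
    rw [SimpleGraph.egirth_eq_top.2 h] at hg
    exact ENat.top_ne_natCast g hg
  obtain ⟨u, w, hw, hwl⟩ := SimpleGraph.exists_egirth_eq_length.2 hac
  have hgl : w.length = g := by
    rw [hg] at hwl
    exact_mod_cast hwl.symm
  subst hgl
  have h3 : 3 ≤ w.length := hw.three_le_length
  have hpos : ∀ v, 1 ≤ G.degree v := by
    intro v
    have : Nontrivial V := by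
      rw [← Fintype.one_lt_card_iff_nontrivial]; omega
    exact hconn.preconnected.degree_pos_of_nontrivial v
  -- the main dichotomy when the cycle is not spanning
  have main : w.length < n →
      ((∃ a b, a ≠ b ∧ G.degree a = 1 ∧ G.degree b = 1) ∧ 2 * √3 * (n + 1) ≤ EUS G ∧
        ¬ Nonempty (G ≃g cycleWithPath n w.length)) ∨
      (EUS G = 2 * √3 * n + 3 * (√19 - 2 * √3) + (√7 - 2 * √3) +
        (if n = w.length + 1 then √13 - √19 - √7 + 2 * √3 else 0) ∧
        Nonempty (G ≃g cycleWithPath n w.length)) := by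
    intro hlt
    by_cases hu : ∀ a b, G.degree a = 1 → G.degree b = 1 → a = b
    · right
      obtain ⟨c, hcyc, hc0⟩ := rebase G n hcard hconn u w hw hlt
      obtain ⟨a, hab, ha, hb, h2⟩ := degs G n hcard hs hpos hu (c 0) hc0
      obtain ⟨_, hadj, hiso⟩ := structure_thm G n w.length hcard hconn he a (c 0) hab ha hb h2 c
        hcyc rfl
      refine ⟨?_, hiso⟩
      rw [eus_one_leaf G n he a (c 0) hab ha hb h2]
      simp only [hadj]
    · left
      push Not at hu
      obtain ⟨a, b, ha, hb, hab⟩ := hu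
      refine ⟨⟨a, b, hab, ha, hb⟩, two_leaves G n hcard hs a b hab ha hb, ?_⟩
      rintro ⟨φ⟩
      exact hab (leaf_unique_of_iso G n w.length h3 hlt.le φ a b ha hb)
  refine ⟨fun hgn => ?_, fun hgn => ?_, fun hgn => ?_⟩
  · have hcyc := cycFun_of_walk G u w hw
    rw [hgn] at hcyc
    have h1 := cycle_eus G n hcard he hs _ hcyc
    have h2 := cycle_iso G n hcard he _ hcyc
    exact ⟨h1.ge, fun _ => h2, fun _ => h1⟩
  · rw [← hgn]
    rcases main (by omega) with ⟨_, h1, h2⟩ | ⟨h1, h2⟩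
    · have := num1 n
      exact ⟨by linarith, fun h => by linarith, fun h => absurd h h2⟩
    · rw [if_pos (by omega)] at h1
      have h4 : EUS G = 2 * √3 * ((n : ℝ) - 3) + 2 * √19 + √13 := by rw [h1]; ring
      exact ⟨h4.ge, fun _ => h2, fun _ => h4⟩
  · rcases main (by omega) with ⟨_, h1, h2⟩ | ⟨h1, h2⟩
    · have := num2 n
      exact ⟨by linarith, fun h => by linarith, fun h => absurd h h2⟩
    · rw [if_neg (by omega)] at h1
      have h4 : EUS G = 3 * √19 + 2 * ((n : ℝ) - 4) * √3 + √7 := by rw [h1]; ring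
      exact ⟨h4.ge, fun _ => h2, fun _ => h4⟩
end

section
/- Let G be a connected graph of order n ≥ 3 with girth g (so G contains at least one cycle). Then EUS(G) ≥ 2√3·n if g = n; EUS(G) ≥ 2√3·(n−3) + 2√19 + √13 if g = n−1; and EUS(G) ≥ 3√19 + 2(n−4)√3 + √7 if g ≤ n−2. Equality holds if and only if G ≅ C_n (when g = n), G ≅ C_{n,n−1} (when g = n−1), or G ≅ C_{n,g} (when g ≤ n−2). -/
open scoped Classical

/-- The lollipop-type graph: the path `0, …, n-1` together with the edge `{j, n-1}`. -/
def pathLoop (n j : ℕ) : SimpleGraph (Fin n) :=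
  SimpleGraph.fromRel (fun a b => a.val + 1 = b.val ∨ (a.val = j ∧ b.val + 1 = n))

theorem pathLoop_adj {n j : ℕ} (hj : j + 3 ≤ n) (a b : Fin n) :
    (pathLoop n j).Adj a b ↔ (a.val + 1 = b.val ∨ (a.val = j ∧ b.val + 1 = n) ∨
      b.val + 1 = a.val ∨ (b.val = j ∧ a.val + 1 = n)) := by
  simp only [pathLoop, SimpleGraph.fromRel_adj, ne_eq, Fin.ext_iff]
  omega

theorem pathLoop_iso {n g : ℕ} (h3 : 3 ≤ g) (hg : g ≤ n) :
    Nonempty (pathLoop n (n - g) ≃g cycleWithPath n g) := by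
  refine ⟨⟨⟨fun x => ⟨if n - g ≤ x.val then x.val - (n - g) else n - 1 - x.val, ?_⟩,
    fun x => ⟨if x.val < g then n - g + x.val else n - 1 - x.val, ?_⟩, ?_, ?_⟩, ?_⟩⟩
  · have := x.2; split_ifs <;> omega
  · have := x.2; split_ifs <;> omega
  · intro x
    have := x.2
    simp only [Fin.ext_iff]
    split_ifs <;> omega
  · intro x
    have := x.2
    simp only [Fin.ext_iff]
    split_ifs <;> omega
  · intro a b
    have ha := a.2
    have hb := b.2
    rw [pathLoop_adj (by omega)]
    simp only [cycleWithPath, SimpleGraph.fromRel_adj, ne_eq, Fin.ext_iff, Equiv.coe_fn_mk]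
    split_ifs <;> omega

theorem eusWeight_mk {V : Type*} [Fintype V] (G : SimpleGraph V) (a b : V) :
    eusWeight G s(a, b) = Real.sqrt ((G.degree a : ℝ)^2 + (G.degree b : ℝ)^2 +
      (G.degree a : ℝ) * (G.degree b : ℝ)) := rfl

theorem EUS_iso {V W : Type*} [Fintype V] [Fintype W] (G : SimpleGraph V) (H : SimpleGraph W)
    (e : G ≃g H) : EUS G = EUS H := by
  unfold EUS
  refine Finset.sum_nbij' (Sym2.map e) (Sym2.map e.symm) ?_ ?_ ?_ ?_ ?_
  · intro x hx
    induction x with | _ a b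
    rw [SimpleGraph.mem_edgeFinset, SimpleGraph.mem_edgeSet] at hx
    rw [Sym2.map_mk, SimpleGraph.mem_edgeFinset, SimpleGraph.mem_edgeSet]
    exact e.map_adj_iff.2 hx
  · intro x hx
    induction x with | _ a b
    rw [SimpleGraph.mem_edgeFinset, SimpleGraph.mem_edgeSet] at hx
    rw [Sym2.map_mk, SimpleGraph.mem_edgeFinset, SimpleGraph.mem_edgeSet]
    exact e.symm.map_adj_iff.2 hx
  · intro x hx
    induction x with | _ a b
    simp
  · intro x hx
    induction x with | _ a b
    simp
  · intro x hx
    induction x with | _ a b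
    rw [Sym2.map_mk, eusWeight_mk, eusWeight_mk]
    have h1 : H.degree (e a) = G.degree a := e.degree_eq a
    have h2 : H.degree (e b) = G.degree b := e.degree_eq b
    simp only [h1, h2]

theorem sum_fin_eq {n : ℕ} (c : ℕ) :
    (∑ b : Fin n, if b.val = c then 1 else 0) = if c < n then 1 else 0 := by
  rw [Fin.sum_univ_eq_sum_range (fun b => if b = c then 1 else 0) n]
  simp

theorem pathLoop_degree {n j : ℕ} (hj : j + 3 ≤ n) (v : Fin n) :
    (pathLoop n j).degree v + (if v.val = 0 then 1 else 0) = 2 + (if v.val = j then 1 else 0) := by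
  have hv := v.2
  have h1 : (pathLoop n j).degree v =
      ∑ b : Fin n, if (pathLoop n j).Adj v b then 1 else 0 := by
    rw [← SimpleGraph.card_neighborFinset_eq_degree, SimpleGraph.neighborFinset_eq_filter,
      Finset.card_filter]
  have h2 : ∀ b : Fin n, (if (pathLoop n j).Adj v b then 1 else 0) =
      (if b.val = v.val + 1 then 1 else 0) + (if b.val = (if v.val = 0 then n else v.val - 1) then 1 else 0) +
      (if b.val = (if v.val = j then n - 1 else n) then 1 else 0) +
      (if b.val = (if v.val = n - 1 then j else n) then 1 else 0) := by
    intro b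
    have hb := b.2
    simp only [pathLoop_adj hj]
    split_ifs <;> omega
  rw [h1, Finset.sum_congr rfl (fun b _ => h2 b)]
  simp only [Finset.sum_add_distrib, sum_fin_eq]
  split_ifs <;> omega

theorem pathLoop_edgeFinset {n j : ℕ} (hj : j + 3 ≤ n) :
    (pathLoop n j).edgeFinset = Finset.univ.image
      (fun i : Fin n => s(i, if h : i.val + 1 < n then ⟨i.val + 1, h⟩ else ⟨j, by omega⟩)) := by
  ext x
  induction x with | _ a b
  have ha := a.2
  have hb := b.2
  simp only [SimpleGraph.mem_edgeFinset, SimpleGraph.mem_edgeSet, pathLoop_adj hj, Finset.mem_image,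
    Finset.mem_univ, true_and, Sym2.eq_iff]
  constructor
  · rintro (h | h | h | h)
    · exact ⟨a, Or.inl ⟨rfl, by rw [dif_pos (by omega)]; ext; exact h⟩⟩
    · exact ⟨b, Or.inr ⟨rfl, by rw [dif_neg (by omega)]; ext; exact h.1.symm⟩⟩
    · exact ⟨b, Or.inr ⟨rfl, by rw [dif_pos (by omega)]; ext; exact h⟩⟩
    · exact ⟨a, Or.inl ⟨rfl, by rw [dif_neg (by omega)]; ext; exact h.1.symm⟩⟩
  · rintro ⟨i, ⟨rfl, h⟩ | ⟨rfl, h⟩⟩ <;> split_ifs at h <;> simp only [Fin.ext_iff] at h <;> omega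

/-- The degree function of `pathLoop`, as a real number. -/
noncomputable def plDeg (j i : ℕ) : ℝ := 2 + (if i = j then 1 else 0) - (if i = 0 then 1 else 0)

theorem pathLoop_degree_real {n j : ℕ} (hj : j + 3 ≤ n) (v : Fin n) :
    ((pathLoop n j).degree v : ℝ) = plDeg j v.val := by
  have h := pathLoop_degree hj v
  have h' : (((pathLoop n j).degree v + (if v.val = 0 then 1 else 0) : ℕ) : ℝ) =
    ((2 + (if v.val = j then 1 else 0) : ℕ) : ℝ) := by rw [h]
  push_cast at h'
  unfold plDeg
  linarith

noncomputable def fw (x y : ℝ) : ℝ := Real.sqrt (x ^ 2 + y ^ 2 + x * y)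

theorem EUS_pathLoop_sum {n j : ℕ} (hj : j + 3 ≤ n) :
    EUS (pathLoop n j) = ∑ i ∈ Finset.range n,
      fw (plDeg j i) (plDeg j (if i + 1 < n then i + 1 else j)) := by
  unfold EUS
  rw [pathLoop_edgeFinset hj, Finset.sum_image]
  · rw [← Fin.sum_univ_eq_sum_range
      (fun i => fw (plDeg j i) (plDeg j (if i + 1 < n then i + 1 else j)))]
    refine Finset.sum_congr rfl fun i _ => ?_
    rw [eusWeight_mk]
    simp only [pathLoop_degree_real hj, fw]
    split_ifs <;> rfl
  · intro a _ b _ h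
    have ha := a.2
    have hb := b.2
    simp only [Sym2.eq_iff] at h
    split_ifs at h <;> simp only [Fin.ext_iff] at h <;> ext <;> omega

theorem fw22 : fw 2 2 = 2 * Real.sqrt 3 := by
  unfold fw
  rw [show (2:ℝ)^2 + 2^2 + 2*2 = 2^2 * 3 by norm_num, Real.sqrt_mul (by norm_num),
    Real.sqrt_sq (by norm_num)]

theorem EUS_pathLoop_zero {n : ℕ} (hj : 0 + 3 ≤ n) :
    EUS (pathLoop n 0) = 2 * Real.sqrt 3 * n := by
  have hd : ∀ i, plDeg 0 i = 2 := by intro i; unfold plDeg; split_ifs <;> norm_num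
  rw [EUS_pathLoop_sum hj]
  simp only [hd, fw22, Finset.sum_const, Finset.card_range, nsmul_eq_mul]
  ring

theorem EUS_pathLoop_one {n : ℕ} (hj : 1 + 3 ≤ n) :
    EUS (pathLoop n 1) =
      2 * Real.sqrt 3 * ((n : ℝ) - 3) + 2 * Real.sqrt 19 + Real.sqrt 13 := by
  rw [EUS_pathLoop_sum hj]
  have h : ∀ i ∈ Finset.range n, fw (plDeg 1 i) (plDeg 1 (if i + 1 < n then i + 1 else 1)) =
      2 * Real.sqrt 3 + (if i = 0 then Real.sqrt 13 - 2 * Real.sqrt 3 else 0)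
        + (if i = 1 then Real.sqrt 19 - 2 * Real.sqrt 3 else 0)
        + (if i = n - 1 then Real.sqrt 19 - 2 * Real.sqrt 3 else 0) := by
    intro i hi
    rw [Finset.mem_range] at hi
    rcases (by omega : i = 0 ∨ i = 1 ∨ i = n - 1 ∨ (1 < i ∧ i + 1 < n)) with h | h | h | h
    · subst h
      rw [if_pos (by omega), if_pos rfl, if_neg (by omega), if_neg (by omega)]
      norm_num [plDeg, fw]
    · subst h
      rw [if_pos (by omega), if_neg (by omega), if_pos rfl, if_neg (by omega)]
      norm_num [plDeg, fw]
    · rw [if_neg (by omega), if_neg (by omega), if_neg (by omega), if_pos h]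
      unfold plDeg
      rw [if_neg (by omega), if_neg (by omega)]
      norm_num [fw]
    · rw [if_pos (by omega), if_neg (by omega), if_neg (by omega), if_neg (by omega)]
      unfold plDeg
      rw [if_neg (by omega), if_neg (by omega), if_neg (by omega), if_neg (by omega)]
      norm_num [fw22]
  rw [Finset.sum_congr rfl h]
  simp only [Finset.sum_add_distrib, Finset.sum_ite_eq', Finset.mem_range, Finset.sum_const,
    Finset.card_range, nsmul_eq_mul]
  rw [if_pos (by omega), if_pos (by omega), if_pos (by omega)]
  ring

theorem EUS_pathLoop_two {n j : ℕ} (h2 : 2 ≤ j) (hj : j + 3 ≤ n) :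
    EUS (pathLoop n j) =
      3 * Real.sqrt 19 + 2 * ((n : ℝ) - 4) * Real.sqrt 3 + Real.sqrt 7 := by
  rw [EUS_pathLoop_sum hj]
  have h : ∀ i ∈ Finset.range n, fw (plDeg j i) (plDeg j (if i + 1 < n then i + 1 else j)) =
      2 * Real.sqrt 3 + (if i = 0 then Real.sqrt 7 - 2 * Real.sqrt 3 else 0)
        + (if i = j - 1 then Real.sqrt 19 - 2 * Real.sqrt 3 else 0)
        + (if i = j then Real.sqrt 19 - 2 * Real.sqrt 3 else 0)
        + (if i = n - 1 then Real.sqrt 19 - 2 * Real.sqrt 3 else 0) := by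
    intro i hi
    rw [Finset.mem_range] at hi
    unfold plDeg
    rcases (by omega : i = 0 ∨ i = j - 1 ∨ i = j ∨ i = n - 1 ∨
      (i ≠ 0 ∧ i ≠ j - 1 ∧ i ≠ j ∧ i + 1 < n)) with h | h | h | h | h
    · rw [if_pos (by omega : i + 1 < n), if_neg (by omega : ¬ i = j), if_pos (by omega : i = 0),
        if_neg (by omega : ¬ i + 1 = j), if_neg (by omega : ¬ i + 1 = 0),
        if_neg (by omega : ¬ i = j - 1), if_neg (by omega : ¬ i = n - 1)]
      rw [if_pos h, if_neg (by omega : ¬ i = j)]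
      norm_num [fw]
    · rw [if_pos (by omega : i + 1 < n), if_neg (by omega : ¬ i = j), if_neg (by omega : ¬ i = 0),
        if_pos (by omega : i + 1 = j), if_neg (by omega : ¬ i + 1 = 0),
        if_pos (by omega : i = j - 1), if_neg (by omega : ¬ i = n - 1), if_neg (by omega : ¬ i = 0),
        if_neg (by omega : ¬ i = j)]
      norm_num [fw]
    · rw [if_pos (by omega : i + 1 < n), if_pos (by omega : i = j), if_neg (by omega : ¬ i = 0),
        if_neg (by omega : ¬ i + 1 = j), if_neg (by omega : ¬ i + 1 = 0),
        if_neg (by omega : ¬ i = j - 1), if_neg (by omega : ¬ i = n - 1), if_neg (by omega : ¬ i = 0),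
        if_pos h]
      norm_num [fw]
    · rw [if_neg (by omega : ¬ i + 1 < n), if_neg (by omega : ¬ i = j), if_neg (by omega : ¬ i = 0),
        if_pos rfl, if_neg (by omega : ¬ j = 0),
        if_neg (by omega : ¬ i = j - 1), if_pos (by omega : i = n - 1), if_neg (by omega : ¬ i = 0),
        if_neg (by omega : ¬ i = j)]
      norm_num [fw]
    · rw [if_pos (by omega : i + 1 < n), if_neg (by omega : ¬ i = j), if_neg (by omega : ¬ i = 0),
        if_neg (by omega : ¬ i + 1 = j), if_neg (by omega : ¬ i + 1 = 0),
        if_neg (by omega : ¬ i = j - 1), if_neg (by omega : ¬ i = n - 1), if_neg (by omega : ¬ i = 0),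
        if_neg (by omega : ¬ i = j)]
      norm_num [fw22]
  rw [Finset.sum_congr rfl h]
  simp only [Finset.sum_add_distrib, Finset.sum_ite_eq', Finset.mem_range, Finset.sum_const,
    Finset.card_range, nsmul_eq_mul]
  rw [if_pos (by omega), if_pos (by omega), if_pos (by omega), if_pos (by omega)]
  ring

theorem cycle_support_data {V : Type*} [Fintype V] {G : SimpleGraph V} {a : V} {c : G.Walk a a}
    (hc : c.IsCycle) : ∃ S : Finset V, S.card = c.length ∧
      ∀ v ∈ S, ∃ x ∈ S, ∃ y ∈ S, x ≠ y ∧ G.Adj v x ∧ G.Adj v y := by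
  refine ⟨c.support.tail.toFinset, ?_, ?_⟩
  · rw [List.toFinset_card_of_nodup hc.support_nodup]
    simp
  · have hmem : ∀ v, v ∈ c.support → v ∈ c.support.tail.toFinset := by
      intro v hv
      rw [List.mem_toFinset]
      rcases (SimpleGraph.Walk.mem_support_iff c).1 hv with h | h
      · subst h
        exact SimpleGraph.Walk.end_mem_tail_support hc.not_nil
      · exact h
    intro v hv
    have hv' : v ∈ c.support := List.mem_of_mem_tail (List.mem_toFinset.1 hv)
    have h2 := hc.ncard_neighborSet_toSubgraph_eq_two hv'
    obtain ⟨x, y, hxy, h⟩ := Set.ncard_eq_two.1 h2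
    have hx : c.toSubgraph.Adj v x := by
      have : x ∈ c.toSubgraph.neighborSet v := by rw [h]; simp
      exact this
    have hy : c.toSubgraph.Adj v y := by
      have : y ∈ c.toSubgraph.neighborSet v := by rw [h]; simp
      exact this
    refine ⟨x, hmem x ?_, y, hmem y ?_, hxy, hx.adj_sub, hy.adj_sub⟩
    · exact c.mem_verts_toSubgraph.1 hx.snd_mem
    · exact c.mem_verts_toSubgraph.1 hy.snd_mem

theorem pathLoop_cycle_length {n j : ℕ} (hj : j + 3 ≤ n) {a : Fin n}
    {c : (pathLoop n j).Walk a a} (hc : c.IsCycle) : c.length = n - j := by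
  obtain ⟨S, hS, h⟩ := cycle_support_data hc
  have hne : S.Nonempty := by
    rw [← Finset.card_pos, hS]
    have := hc.three_le_length
    omega
  simp only [pathLoop_adj hj, ne_eq, Fin.ext_iff] at h
  have hlow : ∀ v ∈ S, j ≤ v.val := by
    have hm := S.min'_mem hne
    have h1 : j ≤ (S.min' hne).val := by
      obtain ⟨x, hx, y, hy, hxy, hax, hay⟩ := h _ hm
      have h3 : (S.min' hne).val ≤ x.val := S.min'_le x hx
      have h4 : (S.min' hne).val ≤ y.val := S.min'_le y hy
      omega
    intro v hv
    have h3 : (S.min' hne).val ≤ v.val := S.min'_le v hv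
    omega
  have htop : (⟨n - 1, by omega⟩ : Fin n) ∈ S := by
    have hm := S.max'_mem hne
    have h1 : (S.max' hne).val = n - 1 := by
      have hlt := (S.max' hne).2
      obtain ⟨x, hx, y, hy, hxy, hax, hay⟩ := h _ hm
      have h3 : x.val ≤ (S.max' hne).val := S.le_max' x hx
      have h4 : y.val ≤ (S.max' hne).val := S.le_max' y hy
      have := x.2
      have := y.2
      omega
    have : (⟨n - 1, by omega⟩ : Fin n) = S.max' hne := by ext; exact h1.symm
    rw [this]
    exact hm
  have hall : ∀ k, ∀ hk : j + k + 1 ≤ n, (⟨n - 1 - k, by omega⟩ : Fin n) ∈ S := by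
    intro k
    induction k with
    | zero => intro _; exact htop
    | succ k ih =>
      intro hk
      obtain ⟨x, hx, y, hy, hxy, hax, hay⟩ := h _ (ih (by omega))
      simp only at hax hay
      have hxl := hlow x hx
      have hyl := hlow y hy
      have := x.2
      have := y.2
      rcases (by omega : x.val = n - 1 - (k + 1) ∨ y.val = n - 1 - (k + 1)) with e | e
      · have : (⟨n - 1 - (k + 1), by omega⟩ : Fin n) = x := by ext; exact e.symm
        rw [this]; exact hx
      · have : (⟨n - 1 - (k + 1), by omega⟩ : Fin n) = y := by ext; exact e.symm
        rw [this]; exact hy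
  have hSeq : S = Finset.Ici (⟨j, by omega⟩ : Fin n) := by
    ext v
    rw [Finset.mem_Ici, Fin.le_def]
    refine ⟨hlow v, fun hv => ?_⟩
    have hv2 := v.2
    have := hall (n - 1 - v.val) (by simp only at hv; omega)
    have e : (⟨n - 1 - (n - 1 - v.val), by omega⟩ : Fin n) = v := by ext; simp only; omega
    rwa [e] at this
  rw [← hS, hSeq, Fin.card_Ici]

theorem sum_edge_degrees {V : Type*} [Fintype V] (G : SimpleGraph V) (F : Sym2 V → ℝ)
    (hF : ∀ a b, G.Adj a b → F s(a, b) = (G.degree a : ℝ) + G.degree b) :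
    ∑ e ∈ G.edgeFinset, F e = ∑ v, (G.degree v : ℝ) ^ 2 := by
  have h1 : ∀ e ∈ G.edgeFinset, F e = ∑ v, if v ∈ e then (G.degree v : ℝ) else 0 := by
    intro e he
    induction e with | _ a b
    rw [SimpleGraph.mem_edgeFinset, SimpleGraph.mem_edgeSet] at he
    have hne := he.ne
    rw [hF a b he, ← Finset.sum_filter]
    have : Finset.univ.filter (fun v => v ∈ s(a, b)) = {a, b} := by
      ext v; simp
    rw [this, Finset.sum_pair hne]
  rw [Finset.sum_congr rfl h1, Finset.sum_comm]
  refine Finset.sum_congr rfl fun v _ => ?_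
  rw [← Finset.sum_filter, Finset.sum_const, nsmul_eq_mul, sq]
  congr 2
  rw [← SimpleGraph.card_incidenceFinset_eq_degree, SimpleGraph.incidenceFinset_eq_filter]

theorem EUS_ge {V : Type*} [Fintype V] (G : SimpleGraph V) :
    Real.sqrt 3 / 2 * ∑ v, (G.degree v : ℝ) ^ 2 ≤ EUS G := by
  rw [← sum_edge_degrees G (Sym2.lift ⟨fun a b => (G.degree a : ℝ) + G.degree b,
    fun a b => add_comm _ _⟩) (fun a b _ => rfl), Finset.mul_sum]
  unfold EUS
  refine Finset.sum_le_sum fun e _ => ?_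
  induction e with | _ a b
  rw [eusWeight_mk, Sym2.lift_mk]
  apply Real.le_sqrt_of_sq_le
  simp only
  rw [mul_pow, div_pow, Real.sq_sqrt (by norm_num)]
  nlinarith [sq_nonneg ((G.degree a : ℝ) - G.degree b)]

/-- Either the index is large, or the degree sequence is very restricted. -/
theorem degree_dichotomy {V : Type*} [Fintype V] (G : SimpleGraph V) (hconn : G.Connected)
    (hcyc : ¬ G.IsAcyclic) :
    2 * Real.sqrt 3 * (Fintype.card V) + 2 * Real.sqrt 3 ≤ EUS G ∨
    ∃ w u, ∀ v, G.degree v + (if v = w then 1 else 0) = 2 + (if v = u then 1 else 0) := by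
  have hm : Fintype.card V ≤ G.edgeFinset.card := by
    have h1 := hconn.card_vert_le_card_edgeSet_add_one
    have h2 : Nat.card G.edgeSet + 1 ≠ Nat.card V := fun h =>
      hcyc (SimpleGraph.isTree_iff_connected_and_card.2 ⟨hconn, h⟩).isAcyclic
    rw [Nat.card_eq_fintype_card, Nat.card_eq_fintype_card] at h1 h2
    rw [SimpleGraph.edgeFinset_card]
    omega
  have hsum := G.sum_degrees_eq_twice_card_edges
  set D : V → ℤ := fun v => (G.degree v : ℤ) - 2 with hD
  have hDsum : ∑ v, D v = 2 * ((G.edgeFinset.card : ℤ) - Fintype.card V) := by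
    simp only [hD, Finset.sum_sub_distrib, Finset.sum_const, Finset.card_univ, nsmul_eq_mul]
    have : (∑ v, (G.degree v : ℤ)) = 2 * (G.edgeFinset.card : ℤ) := by exact_mod_cast hsum
    rw [this]; ring
  have hsq : ∑ v, ((G.degree v : ℤ)) ^ 2 = ∑ v, (D v) ^ 2 + 4 * ∑ v, D v + 4 * Fintype.card V := by
    have : ∀ v, (G.degree v : ℤ) ^ 2 = D v ^ 2 + 4 * D v + 4 := by intro v; simp only [hD]; ring
    simp only [this, Finset.sum_add_distrib, ← Finset.mul_sum, Finset.sum_const, Finset.card_univ,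
      nsmul_eq_mul]
    ring
  by_cases hbig : 4 * (Fintype.card V : ℤ) + 4 ≤ ∑ v, ((G.degree v : ℤ)) ^ 2
  · left
    have hb : 4 * (Fintype.card V : ℝ) + 4 ≤ ∑ v, ((G.degree v : ℝ)) ^ 2 := by exact_mod_cast hbig
    have := EUS_ge G
    nlinarith [Real.sqrt_nonneg 3]
  right
  have hsqnn : 0 ≤ ∑ v, (D v) ^ 2 := Finset.sum_nonneg fun v _ => sq_nonneg _
  have hD0 : ∑ v, D v = 0 := by
    have : (Fintype.card V : ℤ) ≤ G.edgeFinset.card := by exact_mod_cast hm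
    omega
  have hsmall : ∑ v, (D v) ^ 2 ≤ 3 := by omega
  have hsub : ∀ T : Finset V, ∑ v ∈ T, (D v) ^ 2 ≤ 3 := fun T =>
    (Finset.sum_le_sum_of_subset_of_nonneg (Finset.subset_univ T) fun v _ _ => sq_nonneg _).trans
      hsmall
  have hbd : ∀ v, -1 ≤ D v ∧ D v ≤ 1 := by
    intro v
    have := hsub {v}
    rw [Finset.sum_singleton] at this
    constructor <;> nlinarith
  by_cases hall : ∀ v, D v = 0
  · obtain ⟨w⟩ := hconn.nonempty
    refine ⟨w, w, fun v => ?_⟩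
    have := hall v
    simp only [hD] at this
    omega
  push Not at hall
  -- the existence of a vertex with deviation `1` and of one with deviation `-1`
  have hpos : ∃ u, 0 < D u := by
    by_contra! hc
    obtain ⟨v, hv⟩ := hall
    exact hv ((Finset.sum_eq_zero_iff_of_nonpos (fun v _ => hc v)).1 hD0 v (Finset.mem_univ v))
  have hneg : ∃ w, D w < 0 := by
    by_contra! hc
    obtain ⟨v, hv⟩ := hall
    exact hv ((Finset.sum_eq_zero_iff_of_nonneg (fun v _ => hc v)).1 hD0 v (Finset.mem_univ v))
  obtain ⟨u, hu⟩ := hpos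
  obtain ⟨w, hw⟩ := hneg
  have hu1 : D u = 1 := by have := hbd u; omega
  have hw1 : D w = -1 := by have := hbd w; omega
  have huw : w ≠ u := by rintro rfl; omega
  have hrest : ∑ v ∈ Finset.univ \ {w, u}, D v = 0 := by
    have := Finset.sum_sdiff (f := D) (Finset.subset_univ ({w, u} : Finset V))
    rw [Finset.sum_pair huw] at this
    omega
  have hrest2 : ∑ v ∈ Finset.univ \ {w, u}, (D v) ^ 2 ≤ 1 := by
    have := Finset.sum_sdiff (f := fun v => D v ^ 2) (Finset.subset_univ ({w, u} : Finset V))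
    rw [Finset.sum_pair huw, hu1, hw1] at this
    omega
  have hzero : ∀ v, v ≠ w → v ≠ u → D v = 0 := by
    intro x hxw hxu
    by_contra hx
    have hxm : x ∈ Finset.univ \ {w, u} := by simp [hxw, hxu]
    have h1 := Finset.sum_erase_add (f := D) _ hxm
    have h2 := Finset.sum_erase_add (f := fun v => D v ^ 2) _ hxm
    have hx2 : 1 ≤ D x ^ 2 := by
      have : 0 < D x ^ 2 := by positivity
      omega
    have h3 : ∑ v ∈ (Finset.univ \ {w, u}).erase x, D v ^ 2 = 0 := by
      have : 0 ≤ ∑ v ∈ (Finset.univ \ {w, u}).erase x, D v ^ 2 :=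
        Finset.sum_nonneg fun v _ => sq_nonneg _
      omega
    have h4 : ∑ v ∈ (Finset.univ \ {w, u}).erase x, D v = 0 := by
      refine Finset.sum_eq_zero fun v hv => ?_
      have := (Finset.sum_eq_zero_iff_of_nonneg (fun v _ => sq_nonneg (D v))).1 h3 v hv
      exact pow_eq_zero_iff (two_ne_zero) |>.1 this
    omega
  refine ⟨w, u, fun v => ?_⟩
  by_cases hvw : v = w
  · subst hvw
    rw [if_pos rfl, if_neg huw]
    simp only [hD] at hw1
    omega
  · by_cases hvu : v = u
    · subst hvu
      rw [if_pos rfl, if_neg hvw]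
      simp only [hD] at hu1
      omega
    · have := hzero v hvw hvu
      rw [if_neg hvw, if_neg hvu]
      simp only [hD] at this
      omega

/-- `s 0, …, s k` is a path of `G` starting at `w`. -/
def IsSeq {V : Type*} (G : SimpleGraph V) (w : V) (k : ℕ) (s : ℕ → V) : Prop :=
  s 0 = w ∧ (∀ i < k, G.Adj (s i) (s (i + 1))) ∧ ∀ a ≤ k, ∀ b ≤ k, s a = s b → a = b

theorem IsSeq.extend {V : Type*} {G : SimpleGraph V} {w : V} {k : ℕ} {s : ℕ → V}
    (h : IsSeq G w k s) (y : V) (hy : G.Adj (s k) y) (hn : ∀ i ≤ k, s i ≠ y) :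
    ∃ t, IsSeq G w (k + 1) t := by
  obtain ⟨h0, h1, h2⟩ := h
  refine ⟨fun i => if i ≤ k then s i else y, ?_, ?_, ?_⟩
  · simpa using h0
  · intro i hi
    by_cases hik : i = k
    · subst hik
      simpa using hy
    · simp only
      rw [if_pos (by omega), if_pos (by omega)]
      exact h1 i (by omega)
  · intro a ha b hb hab
    simp only at hab
    split_ifs at hab with c d d
    · exact h2 a c b d hab
    · exact absurd hab (hn a c)
    · exact absurd hab.symm (hn b d)
    · omega

theorem exists_max_seq {V : Type*} [Fintype V] (G : SimpleGraph V) (w : V) :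
    ∃ k s, IsSeq G w k s ∧ k < Fintype.card V ∧ ∀ y, G.Adj (s k) y → ∃ i ≤ k, s i = y := by
  have hlt : ∀ k s, IsSeq G w k s → k < Fintype.card V := by
    intro k s h
    have hc : ((Finset.range (k + 1)).image s).card = k + 1 := by
      rw [Finset.card_image_of_injOn, Finset.card_range]
      intro a ha b hb hab
      simp only [Finset.coe_range, Set.mem_Iio] at ha hb
      exact h.2.2 a (by omega) b (by omega) hab
    have := Finset.card_le_univ ((Finset.range (k + 1)).image s)
    omega
  let P : ℕ → Prop := fun k => ∃ s, IsSeq G w k s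
  have h0 : P 0 := ⟨fun _ => w, rfl, fun i hi => by omega, fun a ha b hb _ => by omega⟩
  obtain ⟨s, hs⟩ : P (Nat.findGreatest P (Fintype.card V)) :=
    Nat.findGreatest_spec (Nat.zero_le _) h0
  refine ⟨_, s, hs, hlt _ s hs, fun y hy => ?_⟩
  by_contra! hc
  obtain ⟨t, ht⟩ := hs.extend y hy hc
  have := Nat.le_findGreatest (P := P) (hlt _ t ht).le ⟨t, ht⟩
  omega

theorem structure_of_degrees {V : Type*} [Fintype V] (G : SimpleGraph V) (hconn : G.Connected)
    (w u : V) (hdeg : ∀ v, G.degree v + (if v = w then 1 else 0) = 2 + (if v = u then 1 else 0)) :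
    ∃ j, j + 3 ≤ Fintype.card V ∧ Nonempty (pathLoop (Fintype.card V) j ≃g G) := by
  obtain ⟨k, s, ⟨hs0, hs1, hs2⟩, hk, hmax⟩ := exists_max_seq G w
  -- the path is not trivial
  have hk1 : 1 ≤ k := by
    by_contra hk0
    have hk0 : k = 0 := by omega
    subst hk0
    have hd := hdeg w
    rw [if_pos rfl] at hd
    have hpos : 0 < G.degree w := by omega
    obtain ⟨y, hy⟩ := (G.degree_pos_iff_exists_adj w).1 hpos
    obtain ⟨i, hi, rfl⟩ := hmax y (by rw [hs0]; exact hy)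
    have : i = 0 := by omega
    subst this
    rw [hs0] at hy
    exact hy.ne rfl
  -- the last vertex has a second neighbour on the path
  have hj : ∃ j, j + 2 ≤ k ∧ G.Adj (s k) (s j) := by
    have hkw : s k ≠ w := by
      intro h
      have := hs2 k le_rfl 0 (by omega) (by rw [h, hs0])
      omega
    have hd := hdeg (s k)
    rw [if_neg hkw] at hd
    have h2 : 1 < (G.neighborFinset (s k)).card := by
      rw [SimpleGraph.card_neighborFinset_eq_degree]; omega
    obtain ⟨y, hy, hne⟩ := Finset.exists_mem_ne h2 (s (k - 1))
    rw [SimpleGraph.mem_neighborFinset] at hy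
    obtain ⟨j, hjk, rfl⟩ := hmax y hy
    refine ⟨j, ?_, hy⟩
    have e1 : j ≠ k := by rintro rfl; exact hy.ne rfl
    have e2 : j ≠ k - 1 := by rintro rfl; exact hne rfl
    omega
  obtain ⟨j, hjk, hadj⟩ := hj
  have hj3 : j + 3 ≤ k + 1 := by omega
  -- the map from the model graph
  let e : Fin (k + 1) → V := fun i => s i.val
  have hinj : Function.Injective e := by
    intro a b hab
    have := a.2
    have := b.2
    ext
    exact hs2 a.val (by omega) b.val (by omega) hab
  have hhom : ∀ a b, (pathLoop (k + 1) j).Adj a b → G.Adj (e a) (e b) := by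
    intro a b hab
    rw [pathLoop_adj hj3] at hab
    have ha := a.2
    have hb := b.2
    rcases hab with h | ⟨h, h'⟩ | h | ⟨h, h'⟩
    · have := hs1 a.val (by omega)
      rwa [h] at this
    · have hb' : b.val = k := by omega
      change G.Adj (s a.val) (s b.val)
      rw [h, hb']
      exact hadj.symm
    · have := hs1 b.val (by omega)
      rw [h] at this
      exact this.symm
    · have ha' : a.val = k := by omega
      change G.Adj (s a.val) (s b.val)
      rw [h, ha']
      exact hadj
  have hsubset : ∀ a, ((pathLoop (k + 1) j).neighborFinset a).image e ⊆ G.neighborFinset (e a) := by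
    intro a y hy
    rw [Finset.mem_image] at hy
    obtain ⟨b, hb, rfl⟩ := hy
    rw [SimpleGraph.mem_neighborFinset] at hb ⊢
    exact hhom a b hb
  have hcard : ∀ a, (((pathLoop (k + 1) j).neighborFinset a).image e).card =
      (pathLoop (k + 1) j).degree a := by
    intro a
    rw [Finset.card_image_of_injective _ hinj, SimpleGraph.card_neighborFinset_eq_degree]
  have hw : ∀ a : Fin (k + 1), e a = w ↔ a.val = 0 := by
    intro a
    have := a.2
    constructor
    · intro h
      exact hs2 a.val (by omega) 0 (by omega) (by rw [hs0]; exact h)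
    · intro h
      change s a.val = w
      rw [h, hs0]
  have hju : s j = u := by
    have h1 := Finset.card_le_card (hsubset ⟨j, by omega⟩)
    rw [hcard, SimpleGraph.card_neighborFinset_eq_degree] at h1
    have h2 := pathLoop_degree hj3 ⟨j, by omega⟩
    have h3 := hdeg (e ⟨j, by omega⟩)
    simp only [hw] at h3
    by_contra hne
    rw [if_neg (show ¬ e ⟨j, by omega⟩ = u from hne)] at h3
    simp only [if_true] at h2
    omega
  have hu : ∀ a : Fin (k + 1), e a = u ↔ a.val = j := by
    intro a
    have := a.2
    constructor
    · intro h
      exact hs2 a.val (by omega) j (by omega) (by rw [hju]; exact h)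
    · intro h
      change s a.val = u
      rw [h, hju]
  have hnb : ∀ a, ((pathLoop (k + 1) j).neighborFinset a).image e = G.neighborFinset (e a) := by
    intro a
    refine Finset.eq_of_subset_of_card_le (hsubset a) ?_
    rw [hcard, SimpleGraph.card_neighborFinset_eq_degree]
    have h2 := pathLoop_degree hj3 a
    have h3 := hdeg (e a)
    simp only [hw, hu] at h3
    omega
  have hsurj : Function.Surjective e := by
    intro y
    by_contra hy
    obtain ⟨p⟩ := hconn.preconnected (e 0) y
    obtain ⟨d, _, hd1, hd2⟩ := p.exists_boundary_dart (Set.range e) ⟨0, rfl⟩ hy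
    obtain ⟨a, ha⟩ := hd1
    have hmem : d.snd ∈ G.neighborFinset (e a) := by
      rw [SimpleGraph.mem_neighborFinset, ha]
      exact d.adj
    rw [← hnb a, Finset.mem_image] at hmem
    obtain ⟨b, _, hb⟩ := hmem
    exact hd2 ⟨b, hb⟩
  have hn : Fintype.card V = k + 1 := by
    rw [← Fintype.card_of_bijective ⟨hinj, hsurj⟩, Fintype.card_fin]
  rw [hn]
  refine ⟨j, hj3, ⟨⟨Equiv.ofBijective e ⟨hinj, hsurj⟩, ?_⟩⟩⟩
  intro a b
  change G.Adj (e a) (e b) ↔ (pathLoop (k + 1) j).Adj a b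
  refine ⟨fun h => ?_, hhom a b⟩
  rw [← SimpleGraph.mem_neighborFinset, ← hnb a, Finset.mem_image] at h
  obtain ⟨c, hc, hcb⟩ := h
  rw [hinj hcb] at hc
  exact (SimpleGraph.mem_neighborFinset _ _ _).1 hc

/-- The value of the index on the extremal graph, with `j = n - g`. -/
theorem girth_core {V : Type*} [Fintype V] (G : SimpleGraph V) (n g : ℕ)
    (hcard : Fintype.card V = n) (hconn : G.Connected) (hg : G.egirth = (g : ℕ∞)) :
    3 ≤ g ∧ g ≤ n ∧ ((2 * Real.sqrt 3 * n + 2 * Real.sqrt 3 ≤ EUS G) ∨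
      Nonempty (G ≃g cycleWithPath n g)) := by
  subst hcard
  have hcyc : ¬ G.IsAcyclic := by
    rw [← SimpleGraph.egirth_eq_top, hg]
    exact ENat.natCast_ne_top g
  obtain ⟨a, c, hc, hlen⟩ := SimpleGraph.exists_egirth_eq_length.2 hcyc
  have hlen : c.length = g := by
    rw [hg] at hlen
    exact_mod_cast hlen.symm
  have h3 : 3 ≤ g := hlen ▸ hc.three_le_length
  have hgn : g ≤ Fintype.card V := by
    obtain ⟨S, hS, _⟩ := cycle_support_data hc
    rw [← hlen, ← hS]
    exact Finset.card_le_univ S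
  refine ⟨h3, hgn, ?_⟩
  rcases degree_dichotomy G hconn hcyc with h | ⟨w, u, h⟩
  · exact Or.inl h
  · right
    obtain ⟨j, hj, ⟨e⟩⟩ := structure_of_degrees G hconn w u h
    have hc' := hc.map (f := e.symm.toHom) e.symm.injective
    have hl := pathLoop_cycle_length hj hc'
    rw [SimpleGraph.Walk.length_map, hlen] at hl
    have hjg : j = Fintype.card V - g := by omega
    subst hjg
    obtain ⟨e'⟩ := pathLoop_iso h3 hgn
    exact ⟨e.symm.trans e'⟩

/-- Combining a value for the model graph with the dichotomy. -/
theorem finish {V : Type*} [Fintype V] (G : SimpleGraph V) (n g : ℕ) (val : ℝ)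
    (hcore : 3 ≤ g ∧ g ≤ n ∧ ((2 * Real.sqrt 3 * n + 2 * Real.sqrt 3 ≤ EUS G) ∨
      Nonempty (G ≃g cycleWithPath n g)))
    (hval : EUS (pathLoop n (n - g)) = val) (hlt : val < 2 * Real.sqrt 3 * n + 2 * Real.sqrt 3) :
    val ≤ EUS G ∧ (EUS G = val ↔ Nonempty (G ≃g cycleWithPath n g)) := by
  obtain ⟨h3, hgn, h⟩ := hcore
  have hiso : Nonempty (G ≃g cycleWithPath n g) → EUS G = val := by
    rintro ⟨e⟩
    obtain ⟨e'⟩ := pathLoop_iso h3 hgn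
    rw [EUS_iso G _ e, ← EUS_iso _ _ e', hval]
  rcases h with h | h
  · exact ⟨by linarith, fun he => by linarith, hiso⟩
  · exact ⟨(hiso h).ge, fun _ => h, hiso⟩

/-- Let `G` be a connected graph of order `n ≥ 3` with (finite) girth `g`, so `G` contains at
least one cycle. Then `EUS(G) ≥ 2√3·n` if `g = n`, `EUS(G) ≥ 2√3·(n-3) + 2√19 + √13` if
`g = n-1`, and `EUS(G) ≥ 3√19 + 2(n-4)√3 + √7` if `g ≤ n-2`; in each case equality holds if
and only if `G ≅ C_n`, `G ≅ C_{n,n-1}`, `G ≅ C_{n,g}` respectively. -/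
theorem eus_min_connected_girth {V : Type*} [Fintype V] (G : SimpleGraph V) (n g : ℕ)
    (hn : 3 ≤ n) (hcard : Fintype.card V = n)
    (hconn : G.Connected) (hg : G.egirth = (g : ℕ∞)) :
    (g = n →
      2 * Real.sqrt 3 * n ≤ EUS G ∧
        (EUS G = 2 * Real.sqrt 3 * n ↔ Nonempty (G ≃g cycleWithPath n n))) ∧
    (g = n - 1 →
      2 * Real.sqrt 3 * ((n : ℝ) - 3) + 2 * Real.sqrt 19 + Real.sqrt 13 ≤ EUS G ∧
        (EUS G = 2 * Real.sqrt 3 * ((n : ℝ) - 3) + 2 * Real.sqrt 19 + Real.sqrt 13 ↔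
          Nonempty (G ≃g cycleWithPath n (n - 1)))) ∧
    (g + 2 ≤ n →
      3 * Real.sqrt 19 + 2 * ((n : ℝ) - 4) * Real.sqrt 3 + Real.sqrt 7 ≤ EUS G ∧
        (EUS G = 3 * Real.sqrt 19 + 2 * ((n : ℝ) - 4) * Real.sqrt 3 + Real.sqrt 7 ↔
          Nonempty (G ≃g cycleWithPath n g))) := by
  have hcore := girth_core G n g hcard hconn hg
  have s3 : (1.7 : ℝ) < Real.sqrt 3 := Real.lt_sqrt_of_sq_lt (by norm_num)
  have s19 : Real.sqrt 19 < (4.4 : ℝ) := by rw [Real.sqrt_lt' (by norm_num)]; norm_num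
  have s13 : Real.sqrt 13 < (3.7 : ℝ) := by rw [Real.sqrt_lt' (by norm_num)]; norm_num
  have s7 : Real.sqrt 7 < (2.7 : ℝ) := by rw [Real.sqrt_lt' (by norm_num)]; norm_num
  have h3 := hcore.1
  refine ⟨fun h => ?_, fun h => ?_, fun h => ?_⟩
  · subst h
    refine finish G g g _ hcore ?_ (by linarith)
    rw [Nat.sub_self]
    exact EUS_pathLoop_zero (by omega)
  · subst h
    refine finish G n (n - 1) _ hcore ?_ (by linarith)
    rw [show n - (n - 1) = 1 by omega]
    exact EUS_pathLoop_one (by omega)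
  · refine finish G n g _ hcore ?_ (by linarith)
    exact EUS_pathLoop_two (by omega) (by omega)
end

section
/- Let G be a connected graph of order n with exactly p pendant vertices, where n − p ≥ 2. Then EUS(G) ≤ √3·C(n−p−1, 2)·(n−p−1) + p·√(n² − n + 1) + (n−p−1)·√((n−1)(2n−p−2) + (n−p−1)²), with equality if and only if G ≅ K_{n,p}, the graph obtained by attaching p pendant vertices to a single vertex of the complete graph K_{n−p}. -/
open scoped Classical

/-- `Knp n p` : the graph `K_{n,p}` of order `n` obtained from the complete graph on the
vertices `0, …, n-p-1` by attaching the `p` pendant vertices `n-p, …, n-1` to the vertex `0`. -/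
def Knp (n p : ℕ) : SimpleGraph (Fin n) :=
  SimpleGraph.fromRel (fun i j =>
    (i.val < n - p ∧ j.val < n - p) ∨ (i.val = 0 ∧ n - p ≤ j.val))

noncomputable def ff (x y : ℝ) : ℝ := Real.sqrt (x^2 + y^2 + x*y)

lemma ff_symm (x y : ℝ) : ff x y = ff y x := by
  unfold ff; congr 1; ring

lemma ff_nonneg (x y : ℝ) : 0 ≤ ff x y := Real.sqrt_nonneg _

lemma ff_sq (x y : ℝ) : ff x y ^ 2 = x^2 + y^2 + x*y := by
  unfold ff; rw [Real.sq_sqrt]; nlinarith [sq_nonneg (x+y), sq_nonneg x, sq_nonneg y]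

lemma ff_mono {x y x' y' : ℝ} (hx : 0 ≤ x) (hy : 0 ≤ y) (h1 : x ≤ x') (h2 : y ≤ y') :
    ff x y ≤ ff x' y' := by
  unfold ff; apply Real.sqrt_le_sqrt
  have := mul_le_mul h1 h2 hy (hx.trans h1)
  nlinarith

lemma ff_pos {x y : ℝ} (hx : 0 < x) (hy : 0 ≤ y) : 0 < ff x y := by
  unfold ff; apply Real.sqrt_pos.2; positivity

lemma ff_add (x y x' y' : ℝ) : ff (x + x') (y + y') ≤ ff x y + ff x' y' := by
  have h1 := ff_sq x y
  have h2 := ff_sq x' y'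
  have h3 := ff_sq (x+x') (y+y')
  have n1 := ff_nonneg x y
  have n2 := ff_nonneg x' y'
  refine abs_le_of_sq_le_sq' ?_ (add_nonneg n1 n2) |>.2
  have key : x*x' + y*y' + (x*y' + x'*y)/2 ≤ ff x y * ff x' y' := by
    refine abs_le_of_sq_le_sq' ?_ (mul_nonneg n1 n2) |>.2
    rw [mul_pow, h1, h2]
    nlinarith [sq_nonneg (x*y' - x'*y)]
  nlinarith

lemma ff_smul {c : ℝ} (hc : 0 ≤ c) (x y : ℝ) : ff (c*x) (c*y) = c * ff x y := by
  unfold ff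
  rw [show (c*x)^2 + (c*y)^2 + c*x*(c*y) = c^2 * (x^2+y^2+x*y) by ring,
    Real.sqrt_mul (sq_nonneg c), Real.sqrt_sq hc]

lemma ff_conv {M P s t : ℝ} (hs : 0 ≤ s) (ht : 0 ≤ t) (hst : s + t ≤ 1) :
    ff (M + s*P) (M + t*P) ≤ ff M M + (s + t) * (ff (M+P) M - ff M M) := by
  have h : ff (M + s*P) (M+t*P) =
      ff ((1-s-t)*M + s*(M+P) + t*M) ((1-s-t)*M + s*M + t*(M+P)) := by
    congr 1 <;> ring
  rw [h]
  have h1 := ff_add ((1-s-t)*M + s*(M+P)) ((1-s-t)*M + s*M) (t*M) (t*(M+P))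
  have h2 := ff_add ((1-s-t)*M) ((1-s-t)*M) (s*(M+P)) (s*M)
  rw [ff_smul ht] at h1
  rw [ff_smul hs, ff_smul (by linarith)] at h2
  rw [ff_symm M (M+P)] at h1
  linarith

lemma two_EUS {V : Type*} [Fintype V] (G : SimpleGraph V) :
    2 * EUS G = ∑ v, ∑ w ∈ G.neighborFinset v, ff (G.degree v) (G.degree w) := by
  have h1 : ∑ d : G.Dart, eusWeight G d.edge = 2 * EUS G := by
    unfold EUS
    rw [← Finset.sum_fiberwise_of_maps_to (g := fun d : G.Dart => d.edge) (t := G.edgeFinset)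
      (fun d _ => by simpa using d.edge_mem), Finset.mul_sum]
    refine Finset.sum_congr rfl fun e he => ?_
    rw [Finset.sum_congr rfl (g := fun _ => eusWeight G e)
      (by intro d hd; rw [(Finset.mem_filter.1 hd).2])]
    rw [Finset.sum_const, nsmul_eq_mul]
    have := G.dart_edge_fiber_card e (by simpa using he)
    rw [show (Finset.univ.filter fun d : G.Dart => d.edge = e).card = 2 by convert this]
    norm_num
  rw [← h1, ← Finset.sum_fiberwise (g := fun d : G.Dart => d.fst)]
  refine Finset.sum_congr rfl fun v _ => ?_
  symm
  refine Finset.sum_bij (fun w hw => ⟨(v,w), by simpa using hw⟩) ?_ ?_ ?_ ?_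
  · intro w hw; simp
  · intro a _ b _ h; simpa using h
  · rintro ⟨⟨a,b⟩,h⟩ hd
    simp at hd
    subst hd
    exact ⟨b, by simpa using h, rfl⟩
  · intro w hw
    simp [eusWeight, ff, SimpleGraph.Dart.edge]

lemma EUS_struct {V : Type*} [Fintype V] (G : SimpleGraph V) (T : Finset V) (c : V) (hc : c ∈ T)
    (hadj : ∀ i j, G.Adj i j ↔ i ≠ j ∧ ((i ∈ T ∧ j ∈ T) ∨ (i = c ∧ j ∉ T) ∨ (j = c ∧ i ∉ T)))
    (n m p : ℕ) (hcard : Fintype.card V = n) (hT : T.card = m) (hm : 1 ≤ m) (hn : m + p = n) :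
    2 * EUS G = (m-1) * (m - 2) * ff (m-1) (m-1) + 2 * (p * ff 1 (n-1))
      + 2 * ((m - 1) * ff (n-1) (m-1)) := by
  have Nc : G.neighborFinset c = Finset.univ.erase c := by
    ext x; simp [hadj]; grind
  have NT : ∀ v ∈ T.erase c, G.neighborFinset v = T.erase v := by
    intro v hv; ext x; simp [hadj]; grind
  have NP : ∀ v ∈ Tᶜ, G.neighborFinset v = {c} := by
    intro v hv; have hv' := Finset.mem_compl.1 hv; ext x; simp [hadj]; grind
  have dc : (G.degree c : ℝ) = n - 1 := by
    rw [← G.card_neighborFinset_eq_degree, Nc, Finset.card_erase_of_mem (by simp), Finset.card_univ,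
      hcard, Nat.cast_sub (by omega)]; simp
  have dT : ∀ v ∈ T.erase c, (G.degree v : ℝ) = m - 1 := by
    intro v hv
    rw [← G.card_neighborFinset_eq_degree, NT v hv, Finset.card_erase_of_mem (by grind), hT,
      Nat.cast_sub (by omega)]; simp
  have dP : ∀ v ∈ Tᶜ, (G.degree v : ℝ) = 1 := by
    intro v hv
    rw [← G.card_neighborFinset_eq_degree, NP v hv]; simp
  have cP : (Tᶜ.card : ℝ) = p := by
    rw [Finset.card_compl, hcard, hT]; congr 1; omega
  have cT : ((T.erase c).card : ℝ) = m - 1 := by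
    rw [Finset.card_erase_of_mem hc, hT, Nat.cast_sub (by omega)]; simp
  rw [two_EUS, ← Finset.sum_add_sum_compl T, ← Finset.add_sum_erase T _ hc]
  have e1 : ∑ w ∈ G.neighborFinset c, ff (G.degree c) (G.degree w)
      = (m-1) * ff (n-1) (m-1) + p * ff 1 (n-1) := by
    have : (Finset.univ.erase c) = T.erase c ∪ Tᶜ := by
      ext x; simp only [Finset.mem_erase, Finset.mem_union, Finset.mem_compl, Finset.mem_univ]; grind
    rw [Nc, this, Finset.sum_union (by
        rw [Finset.disjoint_left]; intro x hx hx'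
        exact Finset.mem_compl.1 hx' (Finset.mem_of_mem_erase hx)),
      Finset.sum_congr rfl (g := fun _ => ff (n-1) (m-1)) (by intro w hw; rw [dc, dT w hw]),
      Finset.sum_congr (s₁ := Tᶜ) rfl (g := fun _ => ff 1 (n-1))
        (by intro w hw; rw [dc, dP w hw, ff_symm]), Finset.sum_const, Finset.sum_const]
    simp only [nsmul_eq_mul, cP, cT]
  have e2 : ∀ v ∈ T.erase c, ∑ w ∈ G.neighborFinset v, ff (G.degree v) (G.degree w)
      = ff (n-1) (m-1) + (m - 2) * ff (m-1) (m-1) := by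
    intro v hv
    have hcv : c ∈ T.erase v := by grind
    have : (((T.erase v).erase c).card : ℝ) = m - 2 := by
      have h2 : 1 ≤ (T.erase v).card := Finset.card_pos.2 ⟨c, hcv⟩
      rw [Finset.card_erase_of_mem hcv, Nat.cast_sub h2, Finset.card_erase_of_mem (by grind), hT,
        Nat.cast_sub (by omega)]; push_cast; ring
    rw [NT v hv, ← Finset.add_sum_erase _ _ hcv, dc, dT v hv, ff_symm,
      Finset.sum_congr rfl (g := fun _ => ff (m-1) (m-1))
        (by intro w hw; rw [dT w (by grind)]), Finset.sum_const, nsmul_eq_mul, this]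
  have e3 : ∀ v ∈ Tᶜ, ∑ w ∈ G.neighborFinset v, ff (G.degree v) (G.degree w)
      = ff 1 (n-1) := by
    intro v hv
    rw [NP v hv, Finset.sum_singleton, dc, dP v hv]
  rw [e1, Finset.sum_congr rfl e2, Finset.sum_congr rfl e3, Finset.sum_const, Finset.sum_const]
  simp only [nsmul_eq_mul, cP, cT]
  ring

lemma iso_struct {V : Type*} [Fintype V] (G : SimpleGraph V) (n p : ℕ) (hnp : p + 2 ≤ n)
    (φ : G ≃g Knp n p) : ∃ (T : Finset V) (c : V), c ∈ T ∧ T.card = n - p ∧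
      (∀ i j, G.Adj i j ↔ i ≠ j ∧ ((i ∈ T ∧ j ∈ T) ∨ (i = c ∧ j ∉ T) ∨ (j = c ∧ i ∉ T))) := by
  refine ⟨Finset.univ.filter fun v => (φ v).val < n - p, φ.symm ⟨0, by omega⟩, ?_, ?_, ?_⟩
  · simp; omega
  · have : (Finset.univ.filter fun i : Fin n => i.val < n - p).card = n - p := by
      rw [Fin.card_filter_val_lt]; omega
    refine (Finset.card_equiv φ.toEquiv ?_).trans this
    intro i; simp
  · intro i j
    rw [← φ.map_adj_iff]
    have hc : ∀ x, x = φ.symm ⟨0, by omega⟩ ↔ (φ x).val = 0 := by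
      intro x; rw [← φ.injective.eq_iff]; simp [Fin.ext_iff]
    rw [hc, hc, ← φ.injective.ne_iff]
    simp only [Knp, SimpleGraph.fromRel_adj, Finset.mem_filter, Finset.mem_univ, true_and]
    grind

lemma struct_iso {V : Type*} [Fintype V] (G : SimpleGraph V) (n p : ℕ) (hnp : p + 2 ≤ n)
    (hcard : Fintype.card V = n) (T : Finset V) (c : V) (hc : c ∈ T) (hT : T.card = n - p)
    (hadj : ∀ i j, G.Adj i j ↔ i ≠ j ∧ ((i ∈ T ∧ j ∈ T) ∨ (i = c ∧ j ∉ T) ∨ (j = c ∧ i ∉ T))) :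
    Nonempty (G ≃g Knp n p) := by
  have hk : (Finset.univ.filter fun i : Fin n => i.val < n - p).card = n - p := by
    rw [Fin.card_filter_val_lt]; omega
  have c1 : Fintype.card {x // x ∈ T} = Fintype.card {i : Fin n // i.val < n - p} := by
    rw [Fintype.card_coe, hT, Fintype.card_subtype, hk]
  have c2 : Fintype.card {x // ¬ x ∈ T} = Fintype.card {i : Fin n // ¬ i.val < n - p} := by
    rw [Fintype.card_subtype_compl, Fintype.card_subtype_compl, c1, hcard, Fintype.card_fin]
  obtain e1 := Fintype.equivOfCardEq c1
  obtain e2 := Fintype.equivOfCardEq c2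
  let z : {i : Fin n // i.val < n - p} := ⟨⟨0, by omega⟩, by simp; omega⟩
  let e1' := e1.trans (Equiv.swap (e1 ⟨c, hc⟩) z)
  have hz : e1' ⟨c, hc⟩ = z := by simp [e1']
  let φ : V ≃ Fin n := ((Equiv.sumCompl (fun x => x ∈ T)).symm.trans (Equiv.sumCongr e1' e2)).trans
    (Equiv.sumCompl (fun i : Fin n => i.val < n - p))
  have h1 : ∀ x (hx : x ∈ T), φ x = (e1' ⟨x, hx⟩).1 := by
    intro x hx; simp [φ, Equiv.sumCompl_symm_apply_of_pos hx]
  have h2 : ∀ x (hx : x ∉ T), φ x = (e2 ⟨x, hx⟩).1 := by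
    intro x hx; simp [φ, Equiv.sumCompl_symm_apply_of_neg hx]
  have hm : ∀ x, (φ x).val < n - p ↔ x ∈ T := by
    intro x
    by_cases hx : x ∈ T
    · simp only [hx, iff_true]; rw [h1 x hx]; exact (e1' ⟨x, hx⟩).2
    · simp only [hx, iff_false]; rw [h2 x hx]; exact (e2 ⟨x, hx⟩).2
  have hc0 : (φ c).val = 0 := by rw [h1 c hc, hz]
  have hcx : ∀ x, (φ x).val = 0 ↔ x = c := by
    intro x; rw [← φ.injective.eq_iff, Fin.ext_iff, hc0]
  refine ⟨⟨φ, ?_⟩⟩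
  intro i j
  rw [hadj]
  simp only [Knp, SimpleGraph.fromRel_adj, ne_eq, φ.injective.eq_iff, hm, hcx,
    ← not_lt]
  grind

lemma pendant_nb {V : Type*} [Fintype V] (G : SimpleGraph V) (hconn : G.Connected)
    (S : Finset V) (hS : ∀ v, v ∈ S ↔ G.degree v ≠ 1) (hne : S.Nonempty) (w : V) (hw : w ∉ S) :
    ∃ u ∈ S, G.neighborFinset w = {u} := by
  have hw1 : G.degree w = 1 := by by_contra h; exact hw ((hS w).2 h)
  obtain ⟨u, hu⟩ := Finset.card_eq_one.1 ((G.card_neighborFinset_eq_degree w).trans hw1)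
  refine ⟨u, ?_, hu⟩
  by_contra huS
  have hu1 : G.degree u = 1 := by by_contra h; exact huS ((hS u).2 h)
  obtain ⟨w', hw'⟩ := Finset.card_eq_one.1 ((G.card_neighborFinset_eq_degree u).trans hu1)
  have a1 : ∀ x, G.Adj w x ↔ x = u := by
    intro x; rw [← G.mem_neighborFinset, hu, Finset.mem_singleton]
  have a2 : ∀ x, G.Adj u x ↔ x = w' := by
    intro x; rw [← G.mem_neighborFinset, hw', Finset.mem_singleton]
  have : w = w' := (a2 w).1 ((a1 u).2 rfl).symm
  subst this
  obtain ⟨s, hs⟩ := hne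
  have key : ∀ a b (q : G.Walk a b), (a = w ∨ a = u) → (b = w ∨ b = u) := by
    intro a b q
    induction q with
    | nil => exact id
    | cons h q ih =>
      intro ha
      apply ih
      rcases ha with rfl | rfl
      · right; exact (a1 _).1 h
      · left; exact (a2 _).1 h
  obtain ⟨q⟩ := hconn.preconnected w s
  rcases key w s q (Or.inl rfl) with rfl | rfl
  · exact hw hs
  · exact huS hs

lemma main_bound {V : Type*} [Fintype V] (G : SimpleGraph V) (n m p : ℕ)
    (hcard : Fintype.card V = n) (hconn : G.Connected)
    (S : Finset V) (hS : ∀ v, v ∈ S ↔ G.degree v ≠ 1) (hSm : S.card = m)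
    (hm : 2 ≤ m) (hn : m + p = n) :
    2 * EUS G ≤ (m-1) * (m - 2) * ff (m-1) (m-1) + 2 * (p * ff 1 (n-1))
      + 2 * ((m - 1) * ff (n-1) (m-1)) ∧
    (2 * EUS G = (m-1) * (m - 2) * ff (m-1) (m-1) + 2 * (p * ff 1 (n-1))
      + 2 * ((m - 1) * ff (n-1) (m-1)) →
      ∃ c ∈ S, (∀ i j, G.Adj i j ↔
        i ≠ j ∧ ((i ∈ S ∧ j ∈ S) ∨ (i = c ∧ j ∉ S) ∨ (j = c ∧ i ∉ S)))) := by
  have hSne : S.Nonempty := Finset.card_pos.1 (by omega)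
  have hmR : (2:ℝ) ≤ m := by exact_mod_cast hm
  have hnR : (m:ℝ) + p = n := by exact_mod_cast hn
  have hcP : Sᶜ.card = p := by rw [Finset.card_compl, hcard, hSm]; omega
  have hnb : ∀ w, ∃ u, w ∈ Sᶜ → u ∈ S ∧ G.neighborFinset w = {u} := by
    intro w
    by_cases hw : w ∈ S
    · exact ⟨w, by simp [hw]⟩
    · obtain ⟨u, hu⟩ := pendant_nb G hconn S hS hSne w hw
      exact ⟨u, fun _ => hu⟩
  choose u hu using hnb
  have hadjP : ∀ w ∈ Sᶜ, ∀ x, G.Adj w x ↔ x = u w := by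
    intro w hw x; rw [← G.mem_neighborFinset, (hu w hw).2, Finset.mem_singleton]
  have hd1 : ∀ w ∈ Sᶜ, (G.degree w : ℝ) = 1 := by
    intro w hw; rw [← G.card_neighborFinset_eq_degree, (hu w hw).2]; simp
  -- number of pendant neighbours
  let a : V → ℕ := fun v => (Sᶜ.filter (fun w => G.Adj v w)).card
  have ha : ∑ v ∈ S, a v = p := by
    have := Finset.sum_card_bipartiteAbove_eq_sum_card_bipartiteBelow (s := S) (t := Sᶜ)
      (fun v w => G.Adj v w)
    unfold Finset.bipartiteAbove Finset.bipartiteBelow at this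
    rw [show ∑ v ∈ S, a v = _ from this, ← hcP, Finset.card_eq_sum_ones]
    refine Finset.sum_congr rfl fun w hw => ?_
    rw [Finset.card_eq_one]
    refine ⟨u w, ?_⟩
    ext x
    simp only [Finset.mem_filter, Finset.mem_singleton, G.adj_comm x w, hadjP w hw]
    constructor
    · exact fun h => h.2
    · rintro rfl; exact ⟨(hu w hw).1, rfl⟩
  have hdeg : ∀ v ∈ S, G.degree v ≤ (m - 1) + a v := by
    intro v hv
    rw [← G.card_neighborFinset_eq_degree]
    calc _ ≤ (S.erase v ∪ Sᶜ.filter (fun w => G.Adj v w)).card := by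
          apply Finset.card_le_card
          intro x hx
          have hx' : G.Adj v x := by simpa using hx
          have := hx'.ne
          simp only [Finset.mem_union, Finset.mem_erase, Finset.mem_filter, Finset.mem_compl]
          by_cases hxS : x ∈ S
          · left; exact ⟨this.symm, hxS⟩
          · right; exact ⟨hxS, hx'⟩
      _ ≤ _ := by
          refine (Finset.card_union_le _ _).trans ?_
          rw [Finset.card_erase_of_mem hv, hSm]
  let l : V → ℝ := fun v => (a v : ℝ) / p
  have hl0 : ∀ v, 0 ≤ l v := fun v => by positivity
  have hap : ∀ v ∈ S, (a v : ℝ) = l v * p := by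
    intro v hv
    by_cases hp0 : p = 0
    · have : a v ≤ p := ha ▸ Finset.single_le_sum (f := a) (fun _ _ => Nat.zero_le _) hv
      have : a v = 0 := by omega
      simp [l, this]
    · have : (p:ℝ) ≠ 0 := by exact_mod_cast hp0
      simp only [l]; field_simp
  have hLle : ∑ v ∈ S, l v ≤ 1 := by
    simp only [l]
    rw [← Finset.sum_div, ← Nat.cast_sum, ha]
    exact div_self_le_one _
  have hBA : (∑ v ∈ S, l v) * (ff (n-1) (m-1) - ff (m-1) (m-1))
      = ff (n-1) (m-1) - ff (m-1) (m-1) := by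
    by_cases hp0 : p = 0
    · have : (n:ℝ) = m := by rw [← hnR, hp0]; simp
      rw [this]; simp
    · have : (p:ℝ) ≠ 0 := by exact_mod_cast hp0
      simp only [l]
      rw [← Finset.sum_div, ← Nat.cast_sum, ha, div_self this, one_mul]
  have hll : ∀ v ∈ S, ∀ w ∈ S.erase v, l v + l w ≤ 1 := by
    intro v hv w hw
    refine le_trans ?_ hLle
    rw [← Finset.add_sum_erase _ _ hv]
    gcongr
    exact Finset.single_le_sum (f := l) (fun i _ => hl0 i) hw
  set A := ff ((m:ℝ)-1) (m-1) with hA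
  set B := ff ((n:ℝ)-1) (m-1) with hB
  have hA0 : 0 < A := ff_pos (by linarith) (by linarith)
  have hB0 : 0 < B := ff_pos (by rw [← hnR]; have : (0:ℝ) ≤ p := by positivity
                                 linarith) (by linarith)
  let bd : V → V → ℝ := fun v w => A + (l v + l w) * (B - A)
  let g : V → V → ℝ := fun v w => if G.Adj v w then ff (G.degree v) (G.degree w) else 0
  have hbdpos : ∀ v ∈ S, ∀ w ∈ S.erase v, 0 < bd v w := by
    intro v hv w hw
    have h1 := hll v hv w hw
    have h0 : 0 ≤ l v + l w := add_nonneg (hl0 v) (hl0 w)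
    simp only [bd]
    rcases h0.eq_or_lt with h | h
    · rw [← h]; linarith
    · nlinarith [mul_pos h hB0, mul_nonneg (sub_nonneg.2 h1) hA0.le]
  have hgbd : ∀ v ∈ S, ∀ w ∈ S.erase v, g v w ≤ bd v w := by
    intro v hv w hw
    simp only [g]
    split_ifs with h
    · have hw' := Finset.mem_of_mem_erase hw
      have D : ∀ x ∈ S, (G.degree x : ℝ) ≤ ((m:ℝ) - 1) + l x * p := by
        intro x hx
        have := hdeg x hx
        have h2 : (G.degree x : ℝ) ≤ ((m - 1 : ℕ) : ℝ) + a x := by exact_mod_cast this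
        rw [Nat.cast_sub (by omega), hap x hx] at h2
        simpa using h2
      refine (ff_mono (by positivity) (by positivity) (D v hv) (D w hw')).trans ?_
      have := ff_conv (M := (m:ℝ) - 1) (P := p) (hl0 v) (hl0 w) (hll v hv w hw)
      rw [show (m:ℝ) - 1 + p = n - 1 by rw [← hnR]; ring] at this
      exact this
    · exact (hbdpos v hv w hw).le
  have hbdsum : ∑ v ∈ S, ∑ w ∈ S.erase v, bd v w = (m-1) * (m - 2) * A + 2 * ((m-1) * B) := by
    have inner : ∀ v ∈ S, ∑ w ∈ S.erase v, bd v w =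
        (m-1) * A + (m - 1) * (l v * (B - A)) + (B - A) - l v * (B - A) := by
      intro v hv
      have cE : ((S.erase v).card : ℝ) = m - 1 := by
        rw [Finset.card_erase_of_mem hv, hSm, Nat.cast_sub (by omega)]; simp
      have h3 := Finset.add_sum_erase S l hv
      have h4 : (∑ w ∈ S.erase v, l w) * (B - A) = (B - A) - l v * (B - A) := by
        have h5 := hBA
        rw [← h3] at h5
        linarith
      simp only [bd, add_mul, Finset.sum_add_distrib, Finset.sum_const, nsmul_eq_mul, cE,
        ← Finset.sum_mul, h4]
      ring
    rw [Finset.sum_congr rfl inner]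
    simp only [Finset.sum_add_distrib, Finset.sum_sub_distrib, Finset.sum_const, nsmul_eq_mul,
      ← Finset.mul_sum, ← Finset.sum_mul, hSm, hBA]
    ring
  -- split of the sum
  have hP : ∀ w ∈ Sᶜ, ∑ x ∈ G.neighborFinset w, ff (G.degree w) (G.degree x)
      = ff 1 (G.degree (u w)) := by
    intro w hw
    rw [(hu w hw).2, Finset.sum_singleton, hd1 w hw]
  have hsplit : 2 * EUS G = ∑ v ∈ S, ∑ w ∈ S.erase v, g v w
      + 2 * ∑ w ∈ Sᶜ, ff 1 (G.degree (u w)) := by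
    rw [two_EUS, ← Finset.sum_add_sum_compl S, Finset.sum_congr (s₁ := Sᶜ) rfl hP]
    have inner : ∀ v ∈ S, ∑ w ∈ G.neighborFinset v, ff (G.degree v) (G.degree w)
        = ∑ w ∈ S.erase v, g v w + ∑ w ∈ Sᶜ, g v w := by
      intro v hv
      have : G.neighborFinset v = Finset.univ.filter (fun w => G.Adj v w) := by ext; simp
      rw [this, Finset.sum_filter, ← Finset.sum_add_sum_compl S, ← Finset.add_sum_erase S _ hv]
      simp [g]
    rw [Finset.sum_congr rfl inner, Finset.sum_add_distrib, Finset.sum_comm (s := S) (t := Sᶜ)]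
    have h5 : ∀ w ∈ Sᶜ, ∑ v ∈ S, g v w = ff 1 (G.degree (u w)) := by
      intro w hw
      rw [Finset.sum_eq_single_of_mem (u w) (hu w hw).1]
      · simp only [g]
        rw [if_pos ((hadjP w hw _).2 rfl).symm, hd1 w hw, ff_symm]
      · intro v _ hv
        simp only [g]
        rw [if_neg]
        intro h; exact hv ((hadjP w hw _).1 h.symm)
    rw [Finset.sum_congr (s₁ := Sᶜ) rfl h5]
    ring
  have hdn : ∀ v, (G.degree v : ℝ) ≤ n - 1 := by
    intro v
    have := G.degree_lt_card_verts v
    rw [hcard] at this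
    have : (G.degree v : ℝ) + 1 ≤ n := by exact_mod_cast this
    linarith
  have hPle : ∀ w ∈ Sᶜ, ff 1 (G.degree (u w)) ≤ ff 1 (n-1) := fun w _ =>
    ff_mono (by norm_num) (by positivity) le_rfl (hdn _)
  have hX := Finset.sum_le_sum hPle
  have hYi : ∀ v ∈ S, ∑ w ∈ S.erase v, g v w ≤ ∑ w ∈ S.erase v, bd v w :=
    fun v hv => Finset.sum_le_sum (hgbd v hv)
  have hY := Finset.sum_le_sum hYi
  have hXs : ∑ w ∈ Sᶜ, ff 1 ((n:ℝ)-1) = p * ff 1 (n-1) := by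
    rw [Finset.sum_const, nsmul_eq_mul, hcP]
  refine ⟨by linarith, fun heq => ?_⟩
  have hXe := (Finset.sum_eq_sum_iff_of_le hPle).1 (by linarith)
  have hYe := (Finset.sum_eq_sum_iff_of_le hYi).1 (by linarith)
  have hSadj : ∀ v ∈ S, ∀ w ∈ S, v ≠ w → G.Adj v w := by
    intro v hv w hw hvw
    have hw' : w ∈ S.erase v := Finset.mem_erase.2 ⟨hvw.symm, hw⟩
    have h1 := (Finset.sum_eq_sum_iff_of_le (hgbd v hv)).1 (hYe v hv) w hw'
    by_contra h
    have := hbdpos v hv w hw'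
    simp only [g, if_neg h] at h1
    linarith
  have hfull : ∀ w ∈ Sᶜ, ∀ x, x ≠ u w → G.Adj (u w) x := by
    intro w hw x hx
    have h1 := hXe w hw
    have h2 := ff_sq 1 (G.degree (u w))
    rw [h1, ff_sq] at h2
    have h3 := hdn (u w)
    have h4 : (0:ℝ) ≤ G.degree (u w) := by positivity
    have h5 : (G.degree (u w) : ℝ) = n - 1 := by nlinarith
    have h6 : G.degree (u w) + 1 = n := by
      have : (G.degree (u w) : ℝ) + 1 = n := by linarith
      exact_mod_cast this
    have h7 : G.neighborFinset (u w) = Finset.univ.erase (u w) := by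
      apply Finset.eq_of_subset_of_card_le
      · intro y hy
        have : G.Adj (u w) y := by simpa using hy
        simp [this.ne']
      · rw [Finset.card_erase_of_mem (by simp), Finset.card_univ, hcard,
          G.card_neighborFinset_eq_degree]; omega
    rw [← G.mem_neighborFinset, h7]; simp [hx]
  have hc : ∃ c ∈ S, ∀ w ∈ Sᶜ, u w = c := by
    by_cases hne : (Sᶜ).Nonempty
    · obtain ⟨w0, hw0⟩ := hne
      refine ⟨u w0, (hu w0 hw0).1, fun w hw => ?_⟩
      have : w ≠ u w0 := by
        rintro h
        exact (Finset.mem_compl.1 hw) (h ▸ (hu w0 hw0).1)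
      exact ((hadjP w hw _).1 (hfull w0 hw0 w this).symm).symm
    · obtain ⟨c, hc⟩ := hSne
      exact ⟨c, hc, fun w hw => (hne ⟨w, hw⟩).elim⟩
  obtain ⟨c, hcS, hcu⟩ := hc
  refine ⟨c, hcS, fun i j => ?_⟩
  have hPa : ∀ w, w ∉ S → ∀ x, G.Adj w x ↔ x = c := by
    intro w hw x
    have hw' := Finset.mem_compl.2 hw
    rw [hadjP w hw', hcu w hw']
  by_cases hi : i ∈ S
  · by_cases hj : j ∈ S
    · simp only [hi, hj]
      constructor
      · intro h; exact ⟨h.ne, by simp⟩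
      · intro h; exact hSadj i hi j hj h.1
    · rw [G.adj_comm, hPa j hj]; grind
  · rw [hPa i hi]; grind

/-- Let `G` be a connected graph of order `n` with exactly `p` pendant vertices, where
`n - p ≥ 2`. Then
`EUS(G) ≤ √3·C(n-p-1,2)·(n-p-1) + p√(n²-n+1) + (n-p-1)√((n-1)(2n-p-2) + (n-p-1)²)`,
with equality if and only if `G ≅ K_{n,p}`. -/
theorem eus_max_pendant {V : Type*} [Fintype V] (G : SimpleGraph V) (n p : ℕ)
    (hcard : Fintype.card V = n) (hconn : G.Connected)
    (hp : {v : V | G.degree v = 1}.ncard = p) (hnp : p + 2 ≤ n) :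
    EUS G ≤ Real.sqrt 3 * ((n - p - 1).choose 2 : ℝ) * ((n : ℝ) - p - 1) +
        (p : ℝ) * Real.sqrt ((n : ℝ)^2 - n + 1) +
        ((n : ℝ) - p - 1) *
          Real.sqrt (((n : ℝ) - 1) * (2 * n - p - 2) + ((n : ℝ) - p - 1)^2) ∧
      (EUS G = Real.sqrt 3 * ((n - p - 1).choose 2 : ℝ) * ((n : ℝ) - p - 1) +
          (p : ℝ) * Real.sqrt ((n : ℝ)^2 - n + 1) +
          ((n : ℝ) - p - 1) *
            Real.sqrt (((n : ℝ) - 1) * (2 * n - p - 2) + ((n : ℝ) - p - 1)^2) ↔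
        Nonempty (G ≃g Knp n p)) := by
  obtain ⟨m, hm⟩ : ∃ m, m + p = n := ⟨n - p, by omega⟩
  have hm2 : 2 ≤ m := by omega
  have hmR : (m:ℝ) + p = n := by exact_mod_cast hm
  have hch : ((n - p - 1).choose 2 : ℝ) = ((m:ℝ)-1) * (m-2) / 2 := by
    rw [show n - p - 1 = m - 1 by omega, Nat.cast_choose_two, Nat.cast_sub (by omega)]
    push_cast; ring
  have hnm : (n:ℝ) - p - 1 = m - 1 := by rw [← hmR]; ring
  have hA : Real.sqrt 3 * ((m:ℝ) - 1) = ff (m-1) (m-1) := by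
    have h2 : (2:ℝ) ≤ m := by exact_mod_cast hm2
    unfold ff
    rw [show ((m:ℝ)-1)^2 + (m-1)^2 + (m-1)*(m-1) = 3 * (m-1)^2 by ring,
      Real.sqrt_mul (by norm_num), Real.sqrt_sq (by linarith)]
  have hC : Real.sqrt ((n:ℝ)^2 - n + 1) = ff 1 (n-1) := by
    unfold ff; congr 1; ring
  have hB : Real.sqrt (((n : ℝ) - 1) * (2 * n - p - 2) + ((m : ℝ) - 1)^2) = ff (n-1) (m-1) := by
    unfold ff; congr 1; rw [← hmR]; ring
  have hR : Real.sqrt 3 * ((n - p - 1).choose 2 : ℝ) * ((n : ℝ) - p - 1) +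
        (p : ℝ) * Real.sqrt ((n : ℝ)^2 - n + 1) +
        ((n : ℝ) - p - 1) *
          Real.sqrt (((n : ℝ) - 1) * (2 * n - p - 2) + ((n : ℝ) - p - 1)^2) =
      ((m-1) * (m - 2) * ff (m-1) (m-1) + 2 * (p * ff 1 (n-1))
        + 2 * ((m - 1) * ff (n-1) (m-1))) / 2 := by
    rw [hch, hnm, hC, hB, ← hA]; ring
  rw [hR]
  let S : Finset V := Finset.univ.filter fun v => G.degree v ≠ 1
  have hS : ∀ v, v ∈ S ↔ G.degree v ≠ 1 := by intro v; simp [S]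
  have hSm : S.card = m := by
    have h1 : {v : V | G.degree v = 1} = ((Sᶜ : Finset V) : Set V) := by ext v; simp [S]
    rw [h1, Set.ncard_coe_finset, Finset.card_compl, hcard] at hp
    have := Finset.card_le_univ S
    omega
  obtain ⟨hle, heq⟩ := main_bound G n m p hcard hconn S hS hSm hm2 hm
  refine ⟨by linarith, fun h => ?_, fun ⟨φ⟩ => ?_⟩
  · obtain ⟨c, hc, hadj⟩ := heq (by linarith)
    exact struct_iso G n p hnp hcard S c hc (by omega) hadj
  · obtain ⟨T, c, hc, hT, hadj⟩ := iso_struct G n p hnp φ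
    have := EUS_struct G T c hc hadj n m p hcard (by omega) (by omega) hm
    linarith
end
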